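/- Fix q₀ > 0, M > 0 and θ ∈ (0, 1/4). There exists C > 0, depending only on n, Ω, A, q₀, M and θ, with the following property. Let q, q̃ : closure(Ω) → ℝ be Lipschitz with q ≥ q₀, q̃ ≥ q₀, ‖q‖_{W^{1,∞}} ≤ M, ‖q̃‖_{W^{1,∞}} ≤ M and q = q̃ on ∂Ω. Let u, ũ be twice continuously differentiable on closure(Ω), classical solutions of L_q u = 0 and L_{q̃} ũ = 0 with u = ũ on ∂Ω, ‖u‖_{C²(closure(Ω))} ≤ M and ‖ũ‖_{C²(closure(Ω))} ≤ M. Set √I_q := √q·|u| and √I_{q̃} := √q̃·|ũ|. Then ‖u² − ũ²‖_{L^∞(Ω)} ≤ C ‖√I_q − √I_{q̃}‖_{H¹(Ω)}^{θ}. -/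

import Mathlib

open MeasureTheory Metric Set
open scoped RealInnerProductSpace

noncomputable section

/-- The `i`-th partial derivative of a real-valued function on `ℝⁿ`. -/
noncomputable def pd {n : ℕ} (i : Fin n) (f : EuclideanSpace ℝ (Fin n) → ℝ)
    (x : EuclideanSpace ℝ (Fin n)) : ℝ :=
  fderiv ℝ f x (EuclideanSpace.single i 1)

/-- `u` is a classical solution of `L_q u = ∑ᵢⱼ ∂ᵢ (aⁱʲ ∂ⱼ u) + q u = 0` pointwise in `Ω`. -/
def IsSolution {n : ℕ} (A : Fin n → Fin n → EuclideanSpace ℝ (Fin n) → ℝ)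
    (q u : EuclideanSpace ℝ (Fin n) → ℝ) (Ω : Set (EuclideanSpace ℝ (Fin n))) : Prop :=
  ∀ x ∈ Ω, (∑ i, ∑ j, pd i (fun y => A i j y * pd j u y) x) + q x * u x = 0

/-- The `H¹(D)` norm `(∫_D (w² + ‖∇w‖²))^{1/2}`. -/
noncomputable def H1Norm {n : ℕ} (D : Set (EuclideanSpace ℝ (Fin n)))
    (w : EuclideanSpace ℝ (Fin n) → ℝ) : ℝ :=
  (∫ x in D, ((w x) ^ 2 + ‖fderiv ℝ w x‖ ^ 2)) ^ (1 / 2 : ℝ)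

/-- `A = (aⁱʲ)` is symmetric, has `C¹` entries on `closure Ω`, and is uniformly elliptic. -/
def EllipticSym {n : ℕ} (Ω : Set (EuclideanSpace ℝ (Fin n)))
    (A : Fin n → Fin n → EuclideanSpace ℝ (Fin n) → ℝ) : Prop :=
  (∀ i j, ∀ x ∈ closure Ω, A i j x = A j i x) ∧
  (∀ i j, ContDiffOn ℝ 1 (A i j) (closure Ω)) ∧
  (∃ lam > 0, ∀ x ∈ Ω, ∀ ξ : EuclideanSpace ℝ (Fin n),
    lam * ‖ξ‖ ^ 2 ≤ ∑ i, ∑ j, A i j x * ξ i * ξ j)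

/-- `‖f‖_{W^{1,∞}(closure Ω)} = sup |f| + Lip(f) ≤ M`. -/
def W1InfBound {n : ℕ} (Ω : Set (EuclideanSpace ℝ (Fin n)))
    (f : EuclideanSpace ℝ (Fin n) → ℝ) (M : ℝ) : Prop :=
  ∃ K : NNReal, LipschitzOnWith K f (closure Ω) ∧ ∀ x ∈ closure Ω, |f x| + (K : ℝ) ≤ M

/-- `∂Ω` is of class `C^{1,1}`: near each boundary point, after choosing a direction `ν`,
`Ω` is the region on one side of the graph of a function with Lipschitz derivative. -/
def IsC11Boundary {n : ℕ} (Ω : Set (EuclideanSpace ℝ (Fin n))) : Prop :=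
  ∀ x ∈ frontier Ω, ∃ r > 0, ∃ ν : EuclideanSpace ℝ (Fin n), ‖ν‖ = 1 ∧
    ∃ φ : EuclideanSpace ℝ (Fin n) → ℝ, ∃ K : NNReal,
      Differentiable ℝ φ ∧ LipschitzWith K (fderiv ℝ φ) ∧
      ∀ y ∈ ball x r, (y ∈ Ω ↔ ⟪y, ν⟫ < φ (y - ⟪y, ν⟫ • ν))

/-- `u ∈ C²(closure Ω)` with `‖u‖_{C²(closure Ω)} ≤ M`. -/
def C2BoundOn {n : ℕ} (Ω : Set (EuclideanSpace ℝ (Fin n)))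
    (u : EuclideanSpace ℝ (Fin n) → ℝ) (M : ℝ) : Prop :=
  ContDiffOn ℝ 2 u (closure Ω) ∧ (∀ x ∈ closure Ω, |u x| ≤ M) ∧
    ∀ x ∈ Ω, ‖iteratedFDeriv ℝ 1 u x‖ ≤ M ∧ ‖iteratedFDeriv ℝ 2 u x‖ ≤ M

/-- Local Lipschitz continuity at a point. -/
def LLip {E : Type*} [PseudoEMetricSpace E] (f : E → ℝ) (x : E) : Prop :=
  ∃ K : NNReal, ∃ t ∈ nhds x, LipschitzOnWith K f t

lemma LLip.congr {E : Type*} [PseudoEMetricSpace E] {f g : E → ℝ} {x : E} (hf : LLip f x)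
    (h : f =ᶠ[nhds x] g) : LLip g x := by
  obtain ⟨K, t, ht, hK⟩ := hf
  refine ⟨K, t ∩ {y | f y = g y}, Filter.inter_mem ht h, ?_⟩
  intro a ha b hb
  rw [← ha.2, ← hb.2]
  exact hK ha.1 hb.1

lemma LLip.mul {E : Type*} [PseudoEMetricSpace E] {f g : E → ℝ} {x : E} (hf : LLip f x)
    (hg : LLip g x) : LLip (fun y => f y * g y) x := by
  obtain ⟨K, t, ht, hK⟩ := hf
  obtain ⟨L, s, hs, hL⟩ := hg
  have hm : ContDiff ℝ 1 (fun p : ℝ × ℝ => p.1 * p.2) := contDiff_fst.mul contDiff_snd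
  obtain ⟨N, r, hr, hN⟩ := hm.locallyLipschitz (f x, g x)
  have hc : ContinuousAt (fun y => (f y, g y)) x :=
    (hK.continuousOn.continuousAt ht).prodMk (hL.continuousOn.continuousAt hs)
  refine ⟨N * max K L, (t ∩ s) ∩ (fun y => (f y, g y)) ⁻¹' r,
    Filter.inter_mem (Filter.inter_mem ht hs) (hc hr), ?_⟩
  have h1 : LipschitzOnWith (max K L) (fun y => (f y, g y))
      ((t ∩ s) ∩ (fun y => (f y, g y)) ⁻¹' r) :=
    (hK.mono (fun y hy => hy.1.1)).prodMk (hL.mono (fun y hy => hy.1.2))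
  exact hN.comp h1 (fun y hy => hy.2)

lemma LLip.comp_lip {E : Type*} [PseudoEMetricSpace E] {f : E → ℝ} {x : E} (hf : LLip f x)
    {T : ℝ → ℝ} {L : NNReal} (hT : LipschitzWith L T) : LLip (fun y => T (f y)) x := by
  obtain ⟨K, t, ht, hK⟩ := hf
  exact ⟨L * K, t, ht, hT.comp_lipschitzOnWith hK⟩

lemma LLip.of_contDiffAt {E : Type*} [NormedAddCommGroup E] [NormedSpace ℝ E] {f : E → ℝ} {x : E}
    (hf : ContDiffAt ℝ 1 f x) : LLip f x := by
  obtain ⟨K, t, ht, hK⟩ := hf.exists_lipschitzOnWith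
  exact ⟨K, t, ht, hK⟩

lemma lip_of_llip {E : Type*} [NormedAddCommGroup E] [NormedSpace ℝ E] [ProperSpace E]
    {f : E → ℝ} (hf : ∀ x, LLip f x) (hc : HasCompactSupport f) : ∃ K, LipschitzWith K f := by
  have hLL : LocallyLipschitz f := fun x => hf x
  have hcont : Continuous f := hLL.continuous
  obtain ⟨r, hr0, hr⟩ := hc.isCompact.isBounded.subset_ball_lt 0 0
  obtain ⟨K, hK⟩ := (hLL.locallyLipschitzOn (s := closedBall 0 (r+1))).exists_lipschitzOnWith_of_compact
    (isCompact_closedBall _ _)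
  obtain ⟨B, hB⟩ := hc.exists_bound_of_continuous hcont
  have hB0 : 0 ≤ B := (norm_nonneg _).trans (hB 0)
  refine ⟨max K ⟨B, hB0⟩, LipschitzWith.of_dist_le_mul ?_⟩
  have key : ∀ x y, f x ≠ 0 → dist (f x) (f y) ≤ (max K ⟨B, hB0⟩ : NNReal) * dist x y := by
    intro x y hx
    have hxb : x ∈ ball (0:E) r := hr (subset_tsupport _ hx)
    by_cases hy : y ∈ closedBall (0:E) (r+1)
    · refine (hK.dist_le_mul x (ball_subset_closedBall (ball_subset_ball (by linarith) hxb)) y hy).trans ?_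
      gcongr
      exact le_max_left _ _
    · have hy0 : f y = 0 := by
        by_contra h
        exact hy (ball_subset_closedBall (ball_subset_ball (by linarith) (hr (subset_tsupport _ h))))
      have hd : 1 ≤ dist x y := by
        simp only [mem_closedBall, dist_zero_right, not_le, mem_ball] at hy hxb
        have := norm_sub_norm_le y x
        rw [dist_comm, dist_eq_norm]; linarith
      rw [hy0, dist_zero_right]
      calc ‖f x‖ ≤ B := hB x
        _ ≤ (max K ⟨B, hB0⟩ : NNReal) * 1 := by
            rw [mul_one]; exact NNReal.coe_le_coe.2 (le_max_right K ⟨B, hB0⟩)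
        _ ≤ _ := by gcongr
  intro x y
  by_cases hx : f x = 0
  · by_cases hy : f y = 0
    · rw [hx, hy, dist_self]; positivity
    · rw [dist_comm, dist_comm x y]; exact key y x hy
  · exact key x y hx

lemma ibp_one {n : ℕ} {Ω : Set (EuclideanSpace ℝ (Fin n))} (hΩ : IsOpen Ω)
    {f G : EuclideanSpace ℝ (Fin n) → ℝ} (hf : ∀ x, LLip f x) (hc : HasCompactSupport f)
    (hs : tsupport f ⊆ Ω) (hG : ContDiffOn ℝ 1 G Ω) (i : Fin n) :
    Integrable (fun x => f x * pd i G x + G x * pd i f x) (volume.restrict Ω) ∧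
    ∫ x in Ω, (f x * pd i G x + G x * pd i f x) = 0 := by
  set F : EuclideanSpace ℝ (Fin n) → ℝ := fun x => f x * G x with hF
  have hFc : HasCompactSupport F := hc.mul_right
  have hFz : ∀ x, x ∉ tsupport f → F =ᶠ[nhds x] fun _ => 0 := by
    intro x hx
    have := notMem_tsupport_iff_eventuallyEq.1 hx
    filter_upwards [this] with y hy
    simp [hF, hy]
  have hFL : ∀ x, LLip F x := by
    intro x
    by_cases hx : x ∈ tsupport f
    · exact (hf x).mul (LLip.of_contDiffAt (hG.contDiffAt (hΩ.mem_nhds (hs hx))))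
    · exact (LLip.of_contDiffAt (contDiffAt_const (c := (0:ℝ)))).congr (hFz x hx).symm
  obtain ⟨K, hK⟩ := lip_of_llip hFL hFc
  obtain ⟨L, hL⟩ := lip_of_llip hf hc
  set e : EuclideanSpace ℝ (Fin n) := EuclideanSpace.single i 1
  have h0 : ∫ x, lineDeriv ℝ F x (-e) = 0 := by
    have := (LipschitzWith.const (1:ℝ) (α := EuclideanSpace ℝ (Fin n))).integral_lineDeriv_mul_eq
      (μ := volume) hK hFc e
    simp only [mul_one] at this
    rw [← this]
    simp [lineDeriv]
  have hae : ∀ᵐ x ∂(volume : Measure (EuclideanSpace ℝ (Fin n))),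
      lineDeriv ℝ F x (-e) = - Ω.indicator (fun x => f x * pd i G x + G x * pd i f x) x := by
    filter_upwards [hL.ae_differentiableAt (μ := volume)] with x hx
    by_cases hxΩ : x ∈ Ω
    · rw [indicator_of_mem hxΩ]
      have hGd : DifferentiableAt ℝ G x :=
        (hG.contDiffAt (hΩ.mem_nhds hxΩ)).differentiableAt (by norm_num)
      have hd := hx.hasFDerivAt.mul hGd.hasFDerivAt
      have : lineDeriv ℝ F x (-e) = _ := (hd.hasLineDerivAt (-e)).lineDeriv
      rw [this]
      simp [pd, e]
      ring
    · rw [indicator_of_notMem hxΩ]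
      have hz := hFz x (fun h => hxΩ (hs h))
      rw [hz.lineDeriv_eq]
      simp [lineDeriv]
  have hitg : Integrable (fun x => lineDeriv ℝ F x (-e)) volume := by
    have hm := (hK.memLp_lineDeriv (μ := volume) (-e))
    have hsupp : Function.support (fun x => lineDeriv ℝ F x (-e)) ⊆ tsupport f := by
      intro x hx
      by_contra h
      apply hx
      show lineDeriv ℝ F x (-e) = 0
      rw [(hFz x h).lineDeriv_eq]
      simp [lineDeriv]
    rw [← integrableOn_iff_integrable_of_support_subset hsupp]
    haveI : IsFiniteMeasure (volume.restrict (tsupport f)) :=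
      ⟨by simpa using hc.isCompact.measure_lt_top⟩
    exact (hm.restrict _).integrable le_top
  have hitg2 := hitg.congr hae
  have hint3 : Integrable (Ω.indicator (fun x => f x * pd i G x + G x * pd i f x)) volume := by
    simpa using hitg2.neg
  refine ⟨(integrable_indicator_iff hΩ.measurableSet).1 hint3, ?_⟩
  rw [← integral_indicator hΩ.measurableSet]
  rw [integral_congr_ae hae, integral_neg] at h0
  linarith

lemma ibp_div {n : ℕ} {Ω : Set (EuclideanSpace ℝ (Fin n))} (hΩ : IsOpen Ω)
    {f : EuclideanSpace ℝ (Fin n) → ℝ} {G : Fin n → EuclideanSpace ℝ (Fin n) → ℝ}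
    (hf : ∀ x, LLip f x) (hc : HasCompactSupport f)
    (hs : tsupport f ⊆ Ω) (hG : ∀ i, ContDiffOn ℝ 1 (G i) Ω) :
    Integrable (fun x => ∑ i, (f x * pd i (G i) x + G i x * pd i f x)) (volume.restrict Ω) ∧
    ∫ x in Ω, ∑ i, (f x * pd i (G i) x + G i x * pd i f x) = 0 := by
  have h := fun i => ibp_one hΩ hf hc hs (hG i) i
  refine ⟨integrable_finsetSum _ fun i _ => (h i).1, ?_⟩
  rw [integral_finsetSum _ fun i _ => (h i).1]
  exact Finset.sum_eq_zero fun i _ => (h i).2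

/-- cutting off near the boundary -/
lemma cutoff {n : ℕ} {Ω : Set (EuclideanSpace ℝ (Fin n))} (hΩ : IsOpen Ω)
    (hb : Bornology.IsBounded Ω) {φ : EuclideanSpace ℝ (Fin n) → ℝ}
    (hφ : ContinuousOn φ (closure Ω)) (h0 : ∀ x ∈ frontier Ω, φ x = 0)
    {T : ℝ → ℝ} {δ : ℝ} (hδ : 0 < δ) (hT : ∀ s, |s| ≤ δ → T s = 0) :
    HasCompactSupport (Ω.indicator fun x => T (φ x)) ∧
    tsupport (Ω.indicator fun x => T (φ x)) ⊆ Ω := by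
  set K : Set (EuclideanSpace ℝ (Fin n)) := closure Ω ∩ φ ⁻¹' {s | δ ≤ |s|} with hK
  have hKc : IsClosed K := hφ.preimage_isClosed_of_isClosed isClosed_closure
    (isClosed_le continuous_const continuous_abs)
  have hKcomp : IsCompact K := hb.isCompact_closure.of_isClosed_subset hKc inter_subset_left
  have hKΩ : K ⊆ Ω := by
    intro x hx
    by_contra h
    have : x ∈ frontier Ω := by
      rw [frontier, hΩ.interior_eq]; exact ⟨hx.1, h⟩
    have h2 := hx.2
    simp only [mem_preimage, h0 x this, mem_ofPred_eq, abs_zero] at h2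
    linarith
  have hsub : Function.support (Ω.indicator fun x => T (φ x)) ⊆ K := by
    intro x hx
    have hxΩ : x ∈ Ω := by
      by_contra h; exact hx (indicator_of_notMem h _)
    refine ⟨subset_closure hxΩ, ?_⟩
    by_contra h
    apply hx
    rw [indicator_of_mem hxΩ]
    simp only [mem_preimage, mem_ofPred_eq, not_le] at h
    exact hT _ h.le
  have ht : tsupport (Ω.indicator fun x => T (φ x)) ⊆ K := closure_minimal hsub hKc
  exact ⟨hKcomp.of_isClosed_subset (isClosed_tsupport _) ht, ht.trans hKΩ⟩

lemma cutoff_lip {n : ℕ} {Ω : Set (EuclideanSpace ℝ (Fin n))} (hΩ : IsOpen Ω)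
    {g : EuclideanSpace ℝ (Fin n) → ℝ} (hs : tsupport (Ω.indicator g) ⊆ Ω)
    (hg : ∀ x ∈ Ω, LLip g x) : ∀ x, LLip (Ω.indicator g) x := by
  intro x
  by_cases hx : x ∈ Ω
  · refine (hg x hx).congr ?_
    filter_upwards [hΩ.mem_nhds hx] with y hy
    rw [indicator_of_mem hy]
  · exact (LLip.of_contDiffAt (contDiffAt_const (c := (0:ℝ)))).congr
      (notMem_tsupport_iff_eventuallyEq.1 (fun h => hx (hs h))).symm

lemma cutoff_contDiff {n : ℕ} {Ω : Set (EuclideanSpace ℝ (Fin n))} (hΩ : IsOpen Ω)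
    {g : EuclideanSpace ℝ (Fin n) → ℝ} (hs : tsupport (Ω.indicator g) ⊆ Ω)
    (hg : ContDiffOn ℝ 1 g Ω) : ContDiff ℝ 1 (Ω.indicator g) := by
  rw [contDiff_iff_contDiffAt]
  intro x
  by_cases hx : x ∈ Ω
  · refine (hg.contDiffAt (hΩ.mem_nhds hx)).congr_of_eventuallyEq ?_
    filter_upwards [hΩ.mem_nhds hx] with y hy
    rw [indicator_of_mem hy]
  · exact (contDiffAt_const (c := (0:ℝ))).congr_of_eventuallyEq
      (notMem_tsupport_iff_eventuallyEq.1 (fun h => hx (hs h)))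

/-- A `C¹` truncation: derivative -/
def tau (δ s : ℝ) : ℝ := max 0 (min 1 (|s| / δ - 1))

def TT (δ s : ℝ) : ℝ := ∫ x in (0:ℝ)..s, tau δ x

lemma tau_cont (δ : ℝ) : Continuous (tau δ) := by unfold tau; fun_prop
lemma tau_nonneg (δ s : ℝ) : 0 ≤ tau δ s := le_max_left _ _
lemma tau_le_one (δ s : ℝ) : tau δ s ≤ 1 := max_le zero_le_one (min_le_left _ _)
lemma tau_eq_zero {δ s : ℝ} (hδ : 0 < δ) (h : |s| ≤ δ) : tau δ s = 0 := by
  unfold tau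
  have : |s| / δ ≤ 1 := (div_le_one hδ).2 h
  exact max_eq_left ((min_le_right _ _).trans (by linarith))
lemma tau_eq_one {δ s : ℝ} (hδ : 0 < δ) (h : 2 * δ ≤ |s|) : tau δ s = 1 := by
  unfold tau
  have : 2 ≤ |s| / δ := (le_div_iff₀ hδ).2 h
  rw [min_eq_left (by linarith)]; simp
lemma TT_hasDerivAt (δ s : ℝ) : HasDerivAt (TT δ) (tau δ s) s :=
  intervalIntegral.integral_hasDerivAt_right ((tau_cont δ).intervalIntegrable _ _)
    ((tau_cont δ).stronglyMeasurableAtFilter _ _) (tau_cont δ).continuousAt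
lemma TT_contDiff (δ : ℝ) : ContDiff ℝ 1 (TT δ) := by
  rw [contDiff_one_iff_deriv]
  refine ⟨fun s => (TT_hasDerivAt δ s).differentiableAt, ?_⟩
  have : deriv (TT δ) = tau δ := funext fun s => (TT_hasDerivAt δ s).deriv
  rw [this]; exact tau_cont δ
lemma TT_zero (δ : ℝ) : TT δ 0 = 0 := by simp [TT]
lemma TT_lip (δ : ℝ) : LipschitzWith 1 (TT δ) := by
  apply lipschitzWith_of_nnnorm_deriv_le (fun s => (TT_hasDerivAt δ s).differentiableAt)
  intro s
  rw [(TT_hasDerivAt δ s).deriv, ← NNReal.coe_le_coe]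
  simp [abs_of_nonneg (tau_nonneg δ s), tau_le_one]
lemma TT_eq_zero {δ s : ℝ} (hδ : 0 < δ) (h : |s| ≤ δ) : TT δ s = 0 := by
  unfold TT
  rw [intervalIntegral.integral_congr (g := fun _ => (0:ℝ))]
  · simp
  · intro x hx
    apply tau_eq_zero hδ
    rw [abs_le] at h ⊢
    rcases le_total 0 s with h1 | h1
    · rw [uIcc_of_le h1] at hx; exact ⟨by linarith [hx.1], by linarith [hx.2]⟩
    · rw [uIcc_of_ge h1] at hx; exact ⟨by linarith [hx.1], by linarith [hx.2]⟩
lemma TT_abs_le (δ s : ℝ) : |TT δ s| ≤ |s| := by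
  have := (TT_lip δ).dist_le_mul s 0
  simpa [TT_zero, Real.dist_eq] using this
lemma TT_near {δ : ℝ} (hδ : 0 < δ) (s : ℝ) : |TT δ s - s| ≤ 2 * δ := by
  have h1 : ∀ a b : ℝ, |TT δ a - TT δ b| ≤ |a - b| := fun a b => by
    simpa [Real.dist_eq] using (TT_lip δ).dist_le_mul a b
  -- `S = TT - id` has zero derivative beyond `2δ`
  have hpos : ∀ s, 2 * δ ≤ s → TT δ s - s = TT δ (2*δ) - 2*δ := by
    intro s hs
    have : TT δ s - TT δ (2*δ) = ∫ x in (2*δ)..s, tau δ x := by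
      unfold TT
      rw [intervalIntegral.integral_interval_sub_left] <;> exact (tau_cont δ).intervalIntegrable _ _
    rw [intervalIntegral.integral_congr (g := fun _ => (1:ℝ))] at this
    · simp at this; linarith
    · intro x hx
      rw [uIcc_of_le hs] at hx
      exact tau_eq_one hδ (hx.1.trans (le_abs_self _))
  have hneg : ∀ s, s ≤ -(2 * δ) → TT δ s - s = TT δ (-(2*δ)) + 2*δ := by
    intro s hs
    have : TT δ s - TT δ (-(2*δ)) = ∫ x in (-(2*δ))..s, tau δ x := by
      unfold TT
      rw [intervalIntegral.integral_interval_sub_left] <;> exact (tau_cont δ).intervalIntegrable _ _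
    rw [intervalIntegral.integral_congr (g := fun _ => (1:ℝ))] at this
    · simp at this; linarith
    · intro x hx
      rw [uIcc_of_ge hs] at hx
      exact tau_eq_one hδ (by rw [le_abs]; right; linarith [hx.2])
  have hmono : Monotone (TT δ) := by
    apply monotone_of_deriv_nonneg (fun s => (TT_hasDerivAt δ s).differentiableAt)
    intro x; rw [(TT_hasDerivAt δ x).deriv]; exact tau_nonneg _ _
  have h00 := TT_zero δ
  have small : ∀ s, |s| ≤ 2*δ → |TT δ s - s| ≤ 2 * δ := by
    intro s hs
    have h2 := TT_abs_le δ s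
    rcases le_total 0 s with h | h
    · have := hmono h
      rw [abs_of_nonneg h] at hs h2
      rw [abs_le] at h2 ⊢; constructor <;> linarith [h2.1, h2.2]
    · have := hmono h
      rw [abs_of_nonpos h] at hs h2
      rw [abs_le] at h2 ⊢; constructor <;> linarith [h2.1, h2.2]
  rcases le_total |s| (2*δ) with h | h
  · exact small s h
  · rcases le_abs.1 h with h | h
    · rw [hpos s h]; exact small _ (by rw [abs_of_pos (by linarith)])
    · have h3 := hneg s (by linarith)
      have h4 := small (-(2*δ)) (by rw [abs_neg, abs_of_pos (by linarith)])
      rw [h3]; simpa using h4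

set_option maxHeartbeats 1000000 in
lemma alg_main {M K σ S u v s t gg gp pp τ ε bu bv du dv T1 δ : ℝ}
    (hσ : 0 < σ) (hs : σ ≤ s) (ht : σ ≤ t) (hs' : s ≤ S) (ht' : t ≤ S)
    (hu : |u| ≤ M) (hv : |v| ≤ M) (hgg : 0 ≤ gg) (hgg' : gg ≤ K) (hpp : 0 ≤ pp) (hpp' : pp ≤ K)
    (hgp : |gp| ≤ K) (hτ : 0 ≤ τ) (hτ' : τ ≤ 1) (hε : 0 < ε) (hbu : |bu| ≤ 2) (hbv : |bv| ≤ 2)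
    (hub : 0 ≤ u * bu) (hvb : 0 ≤ v * bv) (hdu : 0 ≤ du) (hdv : 0 ≤ dv) (hδ : 0 ≤ δ)
    (hT : |T1 - bu * bv * (u^2 - v^2) / (u^2 + v^2 + ε)| ≤ 2 * δ) :
    4 * τ * (u * v * bu * bv) * (v^2 * gg - 2 * u * v * gp + u^2 * pp) / (u^2 + v^2 + ε)^2
      + 4 * σ^2 * (u * v * bu * bv) / (u^2 + v^2 + ε) * (|u| - |v|)^2
    ≤ (T1 * (u * v * (t^2 - s^2)) +
        τ * (bu * bv * (4 * u * v * (v^2 * gg - 2 * u * v * gp + u^2 * pp)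
              + ε * (2 * u * v * (gg + pp) - 2 * (u^2 + v^2) * gp)) / (u^2 + v^2 + ε)^2
          + (u^2 - v^2) / (u^2 + v^2 + ε) *
            (v * bv * du * gg - u * bu * dv * pp + (v * dv * bu - u * du * bv) * gp)))
      + (2 * M^2 * S^2 * δ + 8 * S * M * abs (s * |u| - t * |v|)
        + 16 * K * (ε * (u^2 + v^2) / (u^2 + v^2 + ε)^2)
        + (2 * K + 2 * S * K / σ) * (|u| * du + |v| * dv)
        + 2 / σ * (abs (s * |u| - t * |v|) * (dv * pp) + abs (s * |u| - t * |v|) * (du * gg))) := by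
  set a := |u| with ha
  set b := |v| with hb
  set w := s * a - t * b with hw
  have ha0 : 0 ≤ a := abs_nonneg _
  have hb0 : 0 ≤ b := abs_nonneg _
  have hM0 : 0 ≤ M := ha0.trans hu
  have hK0 : 0 ≤ K := hgg.trans hgg'
  have hS0 : 0 < S := by linarith
  have hu2 : u^2 = a^2 := (sq_abs u).symm
  have hv2 : v^2 = b^2 := (sq_abs v).symm
  set R := u^2 + v^2 with hR
  set Q := R + ε with hQ
  have hR0 : 0 ≤ R := by positivity
  have hQ0 : 0 < Q := by linarith
  set m := u * v * bu * bv with hm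
  set N := v^2 * gg - 2 * u * v * gp + u^2 * pp with hN
  have hm' : m = (u * bu) * (v * bv) := by rw [hm]; ring
  have hm0 : 0 ≤ m := by rw [hm']; positivity
  have hub2 : u * bu ≤ 2 * a := by
    calc u * bu ≤ |u * bu| := le_abs_self _
      _ = a * |bu| := abs_mul _ _
      _ ≤ a * 2 := by gcongr
      _ = 2 * a := by ring
  have hvb2 : v * bv ≤ 2 * b := by
    calc v * bv ≤ |v * bv| := le_abs_self _
      _ = b * |bv| := abs_mul _ _
      _ ≤ b * 2 := by gcongr
      _ = 2 * b := by ring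
  have hab : 2 * (a * b) ≤ R := by rw [hR, hu2, hv2]; nlinarith [sq_nonneg (a - b)]
  have hm2 : m ≤ 2 * Q := by
    have : m ≤ (2 * a) * (2 * b) := by rw [hm']; gcongr
    linarith
  have hmQ0 : 0 ≤ m / Q := by positivity
  have hmQ2 : m / Q ≤ 2 := by rw [div_le_iff₀ hQ0]; exact hm2
  have habM : |a - b| ≤ M := by rw [abs_le]; constructor <;> linarith
  -- Step 1
  have step1 : 4 * σ^2 * m / Q * (a - b)^2 ≤ T1 * (u * v * (t^2 - s^2))
      + 2 * M^2 * S^2 * δ + 8 * S * M * |w| := by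
    have e1 : bu * bv * (u^2 - v^2) / Q * (u * v * (t^2 - s^2)) =
        (m / Q) * ((s + t)^2 * (a - b)^2) - (m / Q) * (2 * (s + t) * (a - b) * w) := by
      have : (u^2 - v^2) * (t^2 - s^2) = (s + t)^2 * (a - b)^2 - 2 * (s + t) * (a - b) * w := by
        rw [hu2, hv2, hw]; ring
      calc bu * bv * (u^2 - v^2) / Q * (u * v * (t^2 - s^2))
          = (m / Q) * ((u^2 - v^2) * (t^2 - s^2)) := by rw [hm]; ring
        _ = _ := by rw [this]; ring
    have e2 : |u * v * (t^2 - s^2)| ≤ M^2 * S^2 := by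
      rw [abs_mul, abs_mul]
      have h1 : |t^2 - s^2| ≤ S^2 := by
        have g1 : s^2 ≤ S^2 := pow_le_pow_left₀ (by linarith) hs' 2
        have g2 : t^2 ≤ S^2 := pow_le_pow_left₀ (by linarith) ht' 2
        rw [abs_le]; constructor <;> linarith [sq_nonneg s, sq_nonneg t]
      calc a * b * |t^2 - s^2| ≤ M * M * S^2 := by gcongr
        _ = M^2 * S^2 := by ring
    have e3 : |(T1 - bu * bv * (u^2 - v^2) / Q) * (u * v * (t^2 - s^2))| ≤ 2 * δ * (M^2 * S^2) := by
      rw [abs_mul]; gcongr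
    have e4 : (m / Q) * (4 * σ^2 * (a - b)^2) ≤ (m / Q) * ((s + t)^2 * (a - b)^2) := by
      have : 4 * σ^2 ≤ (s+t)^2 := by
        have := pow_le_pow_left₀ (by linarith) (show 2 * σ ≤ s + t by linarith) 2
        linarith [mul_pow 2 σ 2]
      gcongr
    have e5 : (m / Q) * (2 * (s + t) * (a - b) * w) ≤ 2 * (2 * (S + S) * M * |w|) := by
      calc (m / Q) * (2 * (s + t) * (a - b) * w) ≤ (m / Q) * |2 * (s + t) * (a - b) * w| := by
            gcongr; exact le_abs_self _
        _ = (m / Q) * (2 * (s + t) * |a - b| * |w|) := by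
            rw [abs_mul, abs_mul, abs_of_nonneg (show 0 ≤ 2 * (s + t) by linarith)]
        _ ≤ _ := by
            have : 0 ≤ s + t := by linarith
            gcongr
    have e6 := (abs_le.1 e3).1
    have e7 : 4 * σ^2 * m / Q * (a - b)^2 = (m / Q) * (4 * σ^2 * (a - b)^2) := by ring
    rw [e7]
    rw [sub_mul] at e6
    linarith
  -- Step 2
  have hwb : b ≤ (|w| + S * a) / σ := by
    rw [le_div_iff₀ hσ]
    have h1 : t * b = s * a - w := by rw [hw]; ring
    have h2 : b * σ ≤ t * b := by rw [mul_comm]; gcongr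
    have h3 : s * a ≤ S * a := by gcongr
    linarith [neg_abs_le w]
  have hwa : a ≤ (|w| + S * b) / σ := by
    rw [le_div_iff₀ hσ]
    have h1 : s * a = t * b + w := by rw [hw]; ring
    have h2 : a * σ ≤ s * a := by rw [mul_comm]; gcongr
    have h3 : t * b ≤ S * b := by gcongr
    linarith [le_abs_self w]
  have y1 : |bu * bv * (ε * (2 * u * v * (gg + pp) - 2 * R * gp)) / Q^2| ≤
      16 * K * (ε * R / Q^2) := by
    have hY : |2 * u * v * (gg + pp) - 2 * R * gp| ≤ 4 * R * K := by
      calc |2 * u * v * (gg + pp) - 2 * R * gp| ≤ |2 * u * v * (gg + pp)| + |2 * R * gp| := abs_sub _ _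
        _ = 2 * (a * b) * (gg + pp) + 2 * R * |gp| := by
            rw [abs_mul, abs_mul, abs_mul, abs_mul, abs_mul, abs_of_nonneg hR0,
              abs_of_nonneg (add_nonneg hgg hpp), abs_two, ← ha, ← hb]; ring
        _ ≤ R * (K + K) + 2 * R * K := by gcongr
        _ = 4 * R * K := by ring
    rw [abs_div, abs_mul, abs_mul, abs_mul, abs_of_pos hε, abs_of_nonneg (sq_nonneg Q)]
    calc |bu| * |bv| * (ε * |2 * u * v * (gg + pp) - 2 * R * gp|) / Q^2
        ≤ 2 * 2 * (ε * (4 * R * K)) / Q^2 := by gcongr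
      _ = _ := by ring
  have y2 : |(u^2 - v^2) / Q| ≤ 1 := by
    rw [abs_div, abs_of_pos hQ0, div_le_one hQ0, abs_le]
    constructor <;> linarith [sq_nonneg u, sq_nonneg v]
  have y3 : |v * bv * du * gg - u * bu * dv * pp + (v * dv * bu - u * du * bv) * gp| ≤
      2 * K * (a * du + b * dv) + 2 / σ * (|w| * (dv * pp) + |w| * (du * gg))
        + 2 * S * K / σ * (a * du + b * dv) := by
    have z1 : v * bv * du * gg ≤ 2 / σ * (|w| * (du * gg)) + 2 * S * K / σ * (a * du) := by
      calc v * bv * du * gg ≤ 2 * ((|w| + S * a) / σ) * du * gg := by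
            have := hvb2.trans (show 2 * b ≤ 2 * ((abs w + S * a) / σ) by gcongr)
            exact mul_le_mul_of_nonneg_right (mul_le_mul_of_nonneg_right this hdu) hgg
        _ = 2 / σ * (|w| * (du * gg)) + 2 * S / σ * (a * du) * gg := by ring
        _ ≤ 2 / σ * (|w| * (du * gg)) + 2 * S / σ * (a * du) * K := by gcongr
        _ = _ := by ring
    have z2 : u * bu * dv * pp ≤ 2 / σ * (|w| * (dv * pp)) + 2 * S * K / σ * (b * dv) := by
      calc u * bu * dv * pp ≤ 2 * ((|w| + S * b) / σ) * dv * pp := by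
            have := hub2.trans (show 2 * a ≤ 2 * ((abs w + S * b) / σ) by gcongr)
            exact mul_le_mul_of_nonneg_right (mul_le_mul_of_nonneg_right this hdv) hpp
        _ = 2 / σ * (|w| * (dv * pp)) + 2 * S / σ * (b * dv) * pp := by ring
        _ ≤ 2 / σ * (|w| * (dv * pp)) + 2 * S / σ * (b * dv) * K := by gcongr
        _ = _ := by ring
    have z3 : |(v * dv * bu - u * du * bv) * gp| ≤ 2 * K * (a * du + b * dv) := by
      rw [abs_mul]
      calc |v * dv * bu - u * du * bv| * |gp| ≤ (|v * dv * bu| + |u * du * bv|) * K := by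
            gcongr; exact abs_sub _ _
        _ = (b * dv * |bu| + a * du * |bv|) * K := by
            rw [abs_mul, abs_mul, abs_mul, abs_mul, abs_of_nonneg hdu, abs_of_nonneg hdv]
        _ ≤ (b * dv * 2 + a * du * 2) * K := by gcongr
        _ = _ := by ring
    have z4 : 0 ≤ v * bv * du * gg := by positivity
    have z5 : 0 ≤ u * bu * dv * pp := by positivity
    have z6 := abs_le.1 z3
    rw [abs_le]; constructor <;> linarith [z6.1, z6.2]
  have y4 : |(u^2 - v^2) / Q * (v * bv * du * gg - u * bu * dv * pp + (v * dv * bu - u * du * bv) * gp)|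
      ≤ 2 * K * (a * du + b * dv) + 2 / σ * (|w| * (dv * pp) + |w| * (du * gg))
        + 2 * S * K / σ * (a * du + b * dv) := by
    rw [abs_mul]
    exact (mul_le_of_le_one_left (abs_nonneg _) y2).trans y3
  set Z := (u^2 - v^2) / Q * (v * bv * du * gg - u * bu * dv * pp + (v * dv * bu - u * du * bv) * gp)
  set Y := bu * bv * (ε * (2 * u * v * (gg + pp) - 2 * R * gp)) / Q^2 with hY
  have y5 : bu * bv * (4 * u * v * N + ε * (2 * u * v * (gg + pp) - 2 * R * gp)) / Q^2
      = 4 * m * N / Q^2 + Y := by rw [hY, hm]; ring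
  rw [y5]
  have y6 : 4 * τ * m * N / Q^2 = τ * (4 * m * N / Q^2) := by ring
  rw [y6]
  have y7 : τ * (-Y - Z) ≤ |Y| + |Z| := by
    have : -Y - Z ≤ |Y| + |Z| := by linarith [neg_le_abs Y, neg_le_abs Z]
    calc τ * (-Y - Z) ≤ τ * (|Y| + |Z|) := by gcongr
      _ ≤ |Y| + |Z| := mul_le_of_le_one_left (by positivity) hτ'
  have y8 : τ * (4 * m * N / Q^2 + Y + Z) = τ * (4 * m * N / Q^2) - τ * (-Y - Z) := by ring
  rw [y8, add_mul]
  linarith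

lemma alg_w_aux {M σ S a b s t : ℝ} (hσ : 0 < σ) (hs : σ ≤ s) (ht : σ ≤ t) (ht' : t ≤ S)
    (hb : 0 ≤ b) (hab : b ≤ a) (haM : a ≤ M) (ha0 : 0 < a) :
    (a - b)^2 ≤ 4 * S / σ * (a * b / (a^2 + b^2) * (a - b)^2) + 2 * M / σ * |s * a - t * b| := by
  by_cases h : σ * a / 2 ≤ |s * a - t * b|
  · have h1 : (a - b)^2 ≤ M * a := by nlinarith
    have h2 : M * a ≤ 2 * M / σ * |s * a - t * b| := by
      calc M * a = 2 * M / σ * (σ * a / 2) := by field_simp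
        _ ≤ _ := by gcongr; apply div_nonneg _ hσ.le; linarith
    have h3 : 0 ≤ 4 * S / σ * (a * b / (a^2 + b^2) * (a - b)^2) := by
      have : 0 < S := by linarith
      positivity
    linarith
  · push Not at h
    have h1 := (abs_lt.1 h).2
    have h2 : σ * a / 2 ≤ S * b := by nlinarith
    have h3 : 1 ≤ 4 * S / σ * (a * b / (a^2 + b^2)) := by
      have : 4 * S / σ * (a * b / (a^2 + b^2)) = (4 * S * (a * b)) / (σ * (a^2 + b^2)) := by field_simp
      rw [this, one_le_div (by positivity)]
      have h4 : σ * a * a ≤ 2 * (S * b) * a := by nlinarith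
      have h5 : b^2 ≤ a^2 := by nlinarith
      nlinarith
    have h4 : 0 ≤ 2 * M / σ * |s * a - t * b| := by
      have : 0 ≤ M := by linarith
      positivity
    nlinarith [sq_nonneg (a - b)]

lemma alg_w {M σ S a b s t : ℝ} (hσ : 0 < σ) (hs : σ ≤ s) (ht : σ ≤ t) (hs' : s ≤ S) (ht' : t ≤ S)
    (ha : 0 ≤ a) (hb : 0 ≤ b) (haM : a ≤ M) (hbM : b ≤ M) :
    (a - b)^2 ≤ 4 * S / σ * (a * b / (a^2 + b^2) * (a - b)^2) + 2 * M / σ * |s * a - t * b| := by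
  rcases eq_or_lt_of_le ha with h0 | h0
  · rcases eq_or_lt_of_le hb with h1 | h1
    · rw [← h0, ← h1]; simp
    · have := alg_w_aux hσ ht hs hs' ha (h0 ▸ h1.le) hbM h1
      rw [abs_sub_comm (s * a), mul_comm a b, add_comm (a^2)]
      have e : (a - b)^2 = (b - a)^2 := by ring
      rw [e]; exact this
  · rcases le_total b a with h | h
    · exact alg_w_aux hσ hs ht ht' hb h haM h0
    · have := alg_w_aux hσ ht hs hs' ha h hbM (h0.trans_le h)
      rw [abs_sub_comm (s * a), mul_comm a b, add_comm (a^2)]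
      have e : (a - b)^2 = (b - a)^2 := by ring
      rw [e]; exact this

set_option maxHeartbeats 1000000 in
lemma alg_grad {M lam σ S u v s t N gi pi : ℝ} (hσ : 0 < σ) (hs : σ ≤ s) (ht : σ ≤ t)
    (hs' : s ≤ S) (ht' : t ≤ S) (hl : 0 < lam)
    (hu : |u| ≤ M) (hv : |v| ≤ M) (hg : |gi| ≤ M) (hp : |pi| ≤ M)
    (hN : lam * (v * gi - u * pi)^2 ≤ N) (hR : 0 < u^2 + v^2) :
    |u^2 - v^2| * |2 * (u * gi - v * pi)| ≤
      (16 * M^2 * (4 * S / σ) / σ^2 + 2 * M^2 / lam + 16 * M^2 * (2 * M / σ)) *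
      (|u * v| * N / (u^2 + v^2)^2 + σ^2 * |u * v| / (u^2+v^2) * (|u| - |v|)^2
        + abs (s * |u| - t * |v|)) := by
  have hw := alg_w hσ hs ht hs' ht' (abs_nonneg u) (abs_nonneg v) hu hv
  rw [sq_abs, sq_abs, ← abs_mul] at hw
  set a := |u| with ha
  set b := |v| with hb
  set W := |s * a - t * b|
  have ha0 : 0 ≤ a := abs_nonneg _
  have hb0 : 0 ≤ b := abs_nonneg _
  have hM0 : 0 ≤ M := ha0.trans hu
  have hu2 : u^2 = a^2 := (sq_abs u).symm
  have hv2 : v^2 = b^2 := (sq_abs v).symm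
  have hf : |u^2 - v^2| = |a - b| * (a + b) := by
    rw [hu2, hv2, ← abs_of_nonneg (add_nonneg ha0 hb0), ← abs_mul]; ring_nf
  have hW0 : 0 ≤ W := abs_nonneg _
  set R := u^2 + v^2 with hRd
  set f := u^2 - v^2 with hfd
  set y := v * gi - u * pi with hy
  have hS0 : 0 < S := by linarith
  have hN0 : 0 ≤ N := le_trans (by positivity) hN
  have key : 2 * (u * gi - v * pi) = f * (2 * (u * gi + v * pi)) / R + 4 * (u * v) * y / R := by
    field_simp; rw [hfd, hRd, hy]; ring
  have h1 : f^2 = (a - b)^2 * (a + b)^2 := by rw [← sq_abs f, hf, mul_pow, sq_abs]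
  have hab2 : (a + b)^2 ≤ 2 * R := by rw [hRd, hu2, hv2]; nlinarith [sq_nonneg (a - b)]
  have hRi : |2 * (u * gi + v * pi)| ≤ 4 * M^2 := by
    rw [abs_mul, abs_two]
    have : |u * gi + v * pi| ≤ M * M + M * M := by
      refine (abs_add_le _ _).trans ?_
      rw [abs_mul, abs_mul]
      gcongr
    linarith [sq M]
  have t1 : |f| * |f * (2 * (u * gi + v * pi)) / R| ≤ 8 * M^2 * (a - b)^2 := by
    rw [abs_div, abs_mul, abs_of_pos hR]
    have : |f| * (|f| * |2 * (u * gi + v * pi)| / R) = f^2 * |2 * (u * gi + v * pi)| / R := by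
      rw [← sq_abs f]; ring
    rw [this, h1, div_le_iff₀ hR]
    calc (a - b)^2 * (a+b)^2 * |2 * (u * gi + v * pi)| ≤ (a-b)^2 * (2 * R) * (4 * M^2) := by gcongr
      _ = _ := by ring
  have t2 : |f| * |4 * (u * v) * y / R| ≤ 8 * M^2 * (a - b)^2 + 2 * M^2 / lam * (|u * v| * N / R^2) := by
    have e1 : |f| * |4 * (u * v) * y / R| ≤ 2 * f^2 + 2 * ((u * v) * y / R)^2 := by
      have e2 : 4 * (u * v) * y / R = 4 * ((u * v) * y / R) := by ring
      rw [e2, abs_mul, ← sq_abs f, ← sq_abs (u * v * y / R)]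
      have e3 : abs (4 : ℝ) = 4 := by norm_num
      rw [e3]
      generalize |f| = x1
      generalize |u * v * y / R| = x2
      linarith [sq_nonneg (x1 - x2), sub_sq x1 x2]
    have e3 : f^2 ≤ 4 * M^2 * (a-b)^2 := by
      rw [h1]
      have : (a+b)^2 ≤ 4 * M^2 := by
        have := pow_le_pow_left₀ (by linarith) (show a + b ≤ 2 * M by linarith) 2
        linarith [mul_pow 2 M 2]
      calc (a-b)^2 * (a+b)^2 ≤ (a-b)^2 * (4 * M^2) := by gcongr
        _ = _ := by ring
    have e4 : ((u * v) * y / R)^2 ≤ M^2 / lam * (|u * v| * N / R^2) := by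
      have e5 : y^2 ≤ N / lam := by rw [le_div_iff₀ hl]; linarith
      have e6 : |u * v| ≤ M^2 := by rw [abs_mul, sq]; gcongr
      calc ((u * v) * y / R)^2 = |u * v| * |u * v| * y^2 / R^2 := by
            rw [div_pow, mul_pow, ← sq_abs (u * v)]; ring
        _ ≤ M^2 * |u * v| * (N / lam) / R^2 := by gcongr
        _ = _ := by ring
    have : 2 * M^2 / lam * (|u * v| * N / R^2) = 2 * (M^2 / lam * (|u * v| * N / R^2)) := by ring
    rw [this]; linarith
  have t3 : |f| * |2 * (u * gi - v * pi)| ≤ 16 * M^2 * (a - b)^2 + 2 * M^2 / lam * (|u * v| * N / R^2) := by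
    rw [key]
    calc _ ≤ |f| * (|f * (2 * (u * gi + v * pi)) / R| + |4 * (u * v) * y / R|) := by
          gcongr; exact abs_add_le _ _
      _ ≤ _ := by rw [mul_add]; linarith
  set X1 := |u * v| * N / R^2
  have hX1 : 0 ≤ X1 := by positivity
  have e7 : |u * v| / R * (a - b)^2 = 1 / σ^2 * (σ^2 * |u * v| / R * (a - b)^2) := by
    field_simp
  rw [e7] at hw
  set X2 := σ^2 * |u * v| / R * (a - b)^2
  have hX2 : 0 ≤ X2 := by positivity
  have c1 : 0 ≤ 16 * M^2 * (4 * S / σ) / σ^2 := by positivity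
  have c2 : 0 ≤ 2 * M^2 / lam := by positivity
  have c3 : 0 ≤ 16 * M^2 * (2 * M / σ) := by positivity
  have t4 : 16 * M^2 * (a-b)^2 ≤ 16 * M^2 * (4 * S / σ) / σ^2 * X2 + 16 * M^2 * (2 * M / σ) * W := by
    calc 16 * M^2 * (a-b)^2 ≤ 16 * M^2 * (4 * S / σ * (1 / σ^2 * X2) + 2 * M / σ * W) := by gcongr
      _ = _ := by ring
  have := mul_nonneg c1 hX1
  have := mul_nonneg c1 hW0
  have := mul_nonneg c2 hX2
  have := mul_nonneg c2 hW0
  have := mul_nonneg c3 hX1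
  have := mul_nonneg c3 hX2
  linarith

structure Ell {n : ℕ} (Ω : Set (EuclideanSpace ℝ (Fin n)))
    (A : Fin n → Fin n → EuclideanSpace ℝ (Fin n) → ℝ) (lam Lam : ℝ) : Prop where
  op : IsOpen Ω
  bd : Bornology.IsBounded Ω
  sym : ∀ i j, ∀ x ∈ Ω, A i j x = A j i x
  c1 : ∀ i j, ContDiffOn ℝ 1 (A i j) Ω
  le : ∀ i j, ∀ x ∈ Ω, |A i j x| ≤ Lam
  Lpos : 0 ≤ Lam
  pos : 0 < lam
  ell : ∀ x ∈ Ω, ∀ ξ : EuclideanSpace ℝ (Fin n), lam * ‖ξ‖ ^ 2 ≤ ∑ i, ∑ j, A i j x * ξ i * ξ j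

structure Sol {n : ℕ} (Ω : Set (EuclideanSpace ℝ (Fin n)))
    (A : Fin n → Fin n → EuclideanSpace ℝ (Fin n) → ℝ) (q₀ M : ℝ)
    (q u : EuclideanSpace ℝ (Fin n) → ℝ) : Prop where
  q0 : 0 < q₀
  M0 : 0 < M
  qlip : ∃ K : NNReal, (K : ℝ) ≤ M ∧ LipschitzOnWith K q (closure Ω)
  qlo : ∀ x ∈ closure Ω, q₀ ≤ q x
  qhi : ∀ x ∈ closure Ω, q x ≤ M
  uc : ContinuousOn u (closure Ω)
  u2 : ContDiffOn ℝ 2 u Ω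
  ub : ∀ x ∈ closure Ω, |u x| ≤ M
  ud : ∀ x ∈ Ω, ‖fderiv ℝ u x‖ ≤ M
  sol : IsSolution A q u Ω

def flux {n : ℕ} (A : Fin n → Fin n → EuclideanSpace ℝ (Fin n) → ℝ)
    (u : EuclideanSpace ℝ (Fin n) → ℝ) (i : Fin n) (y : EuclideanSpace ℝ (Fin n)) : ℝ :=
  ∑ j, A i j y * pd j u y

def IP {n : ℕ} (A : Fin n → Fin n → EuclideanSpace ℝ (Fin n) → ℝ)
    (u v : EuclideanSpace ℝ (Fin n) → ℝ) (x : EuclideanSpace ℝ (Fin n)) : ℝ :=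
  ∑ i, flux A v i x * pd i u x

section
variable {n : ℕ} {Ω : Set (EuclideanSpace ℝ (Fin n))}
    {A : Fin n → Fin n → EuclideanSpace ℝ (Fin n) → ℝ} {q₀ M lam Lam : ℝ}
    {q qt u v : EuclideanSpace ℝ (Fin n) → ℝ}

lemma abs_pd_le (f : EuclideanSpace ℝ (Fin n) → ℝ) (x : EuclideanSpace ℝ (Fin n)) (i : Fin n) :
    |pd i f x| ≤ ‖fderiv ℝ f x‖ := by
  have := (fderiv ℝ f x).le_opNorm (EuclideanSpace.single i (1:ℝ))
  simpa [pd] using this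

lemma Sol.pd_le (h : Sol Ω A q₀ M q u) {x} (hx : x ∈ Ω) (i : Fin n) : |pd i u x| ≤ M :=
  (abs_pd_le _ _ _).trans (h.ud x hx)

lemma Sol.diff (h : Sol Ω A q₀ M q u) (hE : Ell Ω A lam Lam) {x} (hx : x ∈ Ω) :
    DifferentiableAt ℝ u x :=
  (h.u2.contDiffAt (hE.op.mem_nhds hx)).differentiableAt (by norm_num)

lemma Sol.u1 (h : Sol Ω A q₀ M q u) : ContDiffOn ℝ 1 u Ω := h.u2.of_le (by norm_num)

lemma Sol.pd_c1 (h : Sol Ω A q₀ M q u) (hE : Ell Ω A lam Lam) (i : Fin n) :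
    ContDiffOn ℝ 1 (pd i u) Ω := by
  have h1 : ContDiffOn ℝ 1 (fderiv ℝ u) Ω := h.u2.fderiv_of_isOpen hE.op (by norm_num)
  exact h1.clm_apply contDiffOn_const

lemma Sol.flux_c1 (h : Sol Ω A q₀ M q u) (hE : Ell Ω A lam Lam) (i : Fin n) :
    ContDiffOn ℝ 1 (flux A u i) Ω := by
  unfold flux
  exact ContDiffOn.sum fun j _ => (hE.c1 i j).mul (h.pd_c1 hE j)

lemma Sol.IP_cont (h : Sol Ω A q₀ M q u) (h' : Sol Ω A q₀ M qt v) (hE : Ell Ω A lam Lam) :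
    ContinuousOn (IP A u v) Ω := by
  unfold IP
  exact continuousOn_finsetSum _ fun i _ =>
    (h'.flux_c1 hE i).continuousOn.mul (h.pd_c1 hE i).continuousOn

lemma Sol.flux_div (h : Sol Ω A q₀ M q u) (hE : Ell Ω A lam Lam) {x} (hx : x ∈ Ω) :
    ∑ i, pd i (flux A u i) x = - (q x * u x) := by
  have h1 := h.sol x hx
  have h2 : ∀ i, pd i (flux A u i) x = ∑ j, pd i (fun y => A i j y * pd j u y) x := by
    intro i
    have hd : ∀ j ∈ Finset.univ, DifferentiableAt ℝ (fun y => A i j y * pd j u y) x := fun j _ =>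
      (((hE.c1 i j).mul (h.pd_c1 hE j)).contDiffAt (hE.op.mem_nhds hx)).differentiableAt (by norm_num)
    unfold pd flux
    have : fderiv ℝ (fun y => ∑ j, A i j y * pd j u y) x = _ := fderiv_fun_sum hd
    rw [this]
    simp [pd]
  simp_rw [h2]
  linarith

lemma Sol.flux_le (h : Sol Ω A q₀ M q u) (hE : Ell Ω A lam Lam) {x} (hx : x ∈ Ω) (i : Fin n) :
    |flux A u i x| ≤ n * (Lam * M) := by
  unfold flux
  refine (Finset.abs_sum_le_sum_abs _ _).trans ?_
  calc ∑ j, |A i j x * pd j u x| ≤ ∑ j : Fin n, Lam * M := by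
        apply Finset.sum_le_sum; intro j _
        rw [abs_mul]
        have := h.M0
        have := hE.Lpos
        exact mul_le_mul (hE.le i j x hx) (h.pd_le hx j) (abs_nonneg _) (by linarith)
    _ = _ := by simp

lemma Sol.IP_le (h : Sol Ω A q₀ M q u) (h' : Sol Ω A q₀ M qt v) (hE : Ell Ω A lam Lam)
    {x} (hx : x ∈ Ω) : |IP A u v x| ≤ n * (n * (Lam * M) * M) := by
  unfold IP
  refine (Finset.abs_sum_le_sum_abs _ _).trans ?_
  calc ∑ j, |flux A v j x * pd j u x| ≤ ∑ j : Fin n, n * (Lam * M) * M := by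
        apply Finset.sum_le_sum; intro j _
        rw [abs_mul]
        have := h.M0
        have := hE.Lpos
        exact mul_le_mul (h'.flux_le hE hx j) (h.pd_le hx j) (abs_nonneg _) (by positivity)
    _ = _ := by simp

lemma IP_eq (x) : IP A u v x = ∑ i, ∑ j, A i j x * pd i u x * pd j v x := by
  unfold IP flux
  refine Finset.sum_congr rfl fun i _ => ?_
  rw [Finset.sum_mul]
  exact Finset.sum_congr rfl fun j _ => by ring

lemma IP_symm (hE : Ell Ω A lam Lam) {x} (hx : x ∈ Ω) : IP A u v x = IP A v u x := by
  rw [IP_eq, IP_eq, Finset.sum_comm]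
  refine Finset.sum_congr rfl fun i _ => Finset.sum_congr rfl fun j _ => ?_
  rw [hE.sym j i x hx]; ring

lemma IP_quad (hE : Ell Ω A lam Lam) {x} (hx : x ∈ Ω) (a b : ℝ) (k : Fin n) :
    lam * (a * pd k u x - b * pd k v x)^2 ≤
      a^2 * IP A u u x - 2 * b * a * IP A u v x + b^2 * IP A v v x := by
  have h := hE.ell x hx (WithLp.toLp 2 fun i => a * pd i u x - b * pd i v x)
  have e : a^2 * IP A u u x - 2 * b * a * IP A u v x + b^2 * IP A v v x =
      ∑ i, ∑ j, A i j x * (a * pd i u x - b * pd i v x) * (a * pd j u x - b * pd j v x) := by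
    have : 2 * b * a * IP A u v x = a * b * IP A u v x + a * b * IP A v u x := by
      rw [IP_symm hE hx (u := v)]; ring
    rw [this]
    simp only [IP_eq, Finset.mul_sum, ← Finset.sum_add_distrib, ← Finset.sum_sub_distrib]
    refine Finset.sum_congr rfl fun i _ => Finset.sum_congr rfl fun j _ => ?_
    ring
  rw [e]
  refine le_trans ?_ h
  have : (a * pd k u x - b * pd k v x)^2 ≤
      ‖(WithLp.toLp 2 fun i => a * pd i u x - b * pd i v x : EuclideanSpace ℝ (Fin n))‖^2 := by
    rw [EuclideanSpace.norm_sq_eq]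
    have := Finset.single_le_sum (f := fun i => ‖(WithLp.toLp 2 fun i => a * pd i u x - b * pd i v x : EuclideanSpace ℝ (Fin n)) i‖^2)
      (fun i _ => by positivity) (Finset.mem_univ k)
    refine le_trans (le_of_eq ?_) this
    simp
  have := hE.pos
  gcongr

lemma IP_nonneg (hE : Ell Ω A lam Lam) {x} (hx : x ∈ Ω) : 0 ≤ IP A u u x := by
  have h := hE.ell x hx (WithLp.toLp 2 fun i => pd i u x)
  rw [IP_eq]
  refine le_trans ?_ h
  have := hE.pos
  positivity

lemma integ_of_cont (hE : Ell Ω A lam Lam) {g : EuclideanSpace ℝ (Fin n) → ℝ} {B : ℝ}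
    (hg : ContinuousOn g Ω) (hB : ∀ x ∈ Ω, |g x| ≤ B) : IntegrableOn g Ω volume := by
  have : IsFiniteMeasure (volume.restrict Ω) := ⟨by simpa using hE.bd.measure_lt_top⟩
  refine Integrable.of_bound (hg.aestronglyMeasurable hE.op.measurableSet) B ?_
  exact (ae_restrict_iff' hE.op.measurableSet).2 (.of_forall hB)

def ww (q qt u v : EuclideanSpace ℝ (Fin n) → ℝ) (y : EuclideanSpace ℝ (Fin n)) : ℝ :=
  Real.sqrt (q y) * |u y| - Real.sqrt (qt y) * |v y|

def LL (q₀ M : ℝ) : ℝ := Real.sqrt M * M + M * (M / Real.sqrt q₀)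

lemma LL_nonneg {q₀ M : ℝ} (hM : 0 ≤ M) : 0 ≤ LL q₀ M := by
  unfold LL; positivity

lemma Sol.lip1 (h : Sol Ω A q₀ M q u) (hE : Ell Ω A lam Lam) {x : EuclideanSpace ℝ (Fin n)} {r : ℝ}
    (hb : ball x r ⊆ Ω) {y z} (hy : y ∈ ball x r) (hz : z ∈ ball x r) :
    abs (Real.sqrt (q y) * |u y| - Real.sqrt (q z) * |u z|) ≤ LL q₀ M * ‖y - z‖ := by
  have hyc := subset_closure (hb hy)
  have hzc := subset_closure (hb hz)
  have hM := h.M0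
  have h1 : |u y - u z| ≤ M * ‖y - z‖ :=
    (convex_ball x r).norm_image_sub_le_of_norm_fderiv_le (fun a ha => h.diff hE (hb ha))
      (fun a ha => h.ud a (hb ha)) hz hy
  obtain ⟨K, hKM, hK⟩ := h.qlip
  have h2 : |q y - q z| ≤ M * ‖y - z‖ := by
    have := hK.dist_le_mul y hyc z hzc
    rw [Real.dist_eq, dist_eq_norm] at this
    exact this.trans (by gcongr)
  have hs0 : 0 < Real.sqrt q₀ := Real.sqrt_pos.2 h.q0
  have hsy : Real.sqrt q₀ ≤ Real.sqrt (q y) := Real.sqrt_le_sqrt (h.qlo y hyc)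
  have hsz : Real.sqrt q₀ ≤ Real.sqrt (q z) := Real.sqrt_le_sqrt (h.qlo z hzc)
  have hsyM : Real.sqrt (q y) ≤ Real.sqrt M := Real.sqrt_le_sqrt (h.qhi y hyc)
  have h3 : |Real.sqrt (q y) - Real.sqrt (q z)| ≤ M / Real.sqrt q₀ * ‖y - z‖ := by
    have e : (Real.sqrt (q y) - Real.sqrt (q z)) * (Real.sqrt (q y) + Real.sqrt (q z)) = q y - q z := by
      have a1 := Real.sq_sqrt (h.q0.le.trans (h.qlo y hyc))
      have a2 := Real.sq_sqrt (h.q0.le.trans (h.qlo z hzc))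
      linear_combination a1 - a2
    rw [div_mul_eq_mul_div, le_div_iff₀ hs0]
    calc |Real.sqrt (q y) - Real.sqrt (q z)| * Real.sqrt q₀
        ≤ |Real.sqrt (q y) - Real.sqrt (q z)| * |Real.sqrt (q y) + Real.sqrt (q z)| := by
          gcongr; rw [abs_of_nonneg (by positivity)]; linarith
      _ = |q y - q z| := by rw [← abs_mul, e]
      _ ≤ _ := h2
  have e : Real.sqrt (q y) * |u y| - Real.sqrt (q z) * |u z| =
      Real.sqrt (q y) * (|u y| - |u z|) + |u z| * (Real.sqrt (q y) - Real.sqrt (q z)) := by ring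
  rw [e]
  refine (abs_add_le _ _).trans ?_
  rw [abs_mul, abs_mul, abs_abs, abs_of_nonneg (Real.sqrt_nonneg _)]
  calc _ ≤ Real.sqrt M * (M * ‖y - z‖) + M * (M / Real.sqrt q₀ * ‖y - z‖) := by
        have := (abs_abs_sub_abs_le (u y) (u z)).trans h1
        have := h.ub z hzc
        gcongr
    _ = _ := by unfold LL; ring

lemma ww_lip (h : Sol Ω A q₀ M q u) (h' : Sol Ω A q₀ M qt v) (hE : Ell Ω A lam Lam)
    {x : EuclideanSpace ℝ (Fin n)} {r : ℝ} (hb : ball x r ⊆ Ω) :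
    LipschitzOnWith (Real.toNNReal (2 * LL q₀ M)) (ww q qt u v) (ball x r) := by
  have hL := LL_nonneg (q₀ := q₀) h.M0.le
  refine LipschitzOnWith.of_dist_le_mul ?_
  intro y hy z hz
  rw [Real.coe_toNNReal _ (by linarith), Real.dist_eq, dist_eq_norm]
  have a1 := h.lip1 hE hb hy hz
  have a2 := h'.lip1 hE hb hy hz
  have : ww q qt u v y - ww q qt u v z = (Real.sqrt (q y) * |u y| - Real.sqrt (q z) * |u z|)
    - (Real.sqrt (qt y) * |v y| - Real.sqrt (qt z) * |v z|) := by unfold ww; ring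
  rw [this]
  refine (abs_sub _ _).trans ?_
  linarith

lemma ww_llip (h : Sol Ω A q₀ M q u) (h' : Sol Ω A q₀ M qt v) (hE : Ell Ω A lam Lam)
    {x} (hx : x ∈ Ω) : LLip (ww q qt u v) x := by
  obtain ⟨r, hr, hb⟩ := Metric.isOpen_iff.1 hE.op x hx
  exact ⟨_, _, ball_mem_nhds x hr, ww_lip h h' hE hb⟩

lemma ww_fderiv_le (h : Sol Ω A q₀ M q u) (h' : Sol Ω A q₀ M qt v) (hE : Ell Ω A lam Lam)
    {x} (hx : x ∈ Ω) : ‖fderiv ℝ (ww q qt u v) x‖ ≤ 2 * LL q₀ M := by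
  obtain ⟨r, hr, hb⟩ := Metric.isOpen_iff.1 hE.op x hx
  have := norm_fderiv_le_of_lipschitzOn ℝ (ball_mem_nhds x hr) (ww_lip h h' hE hb)
  rwa [Real.coe_toNNReal _ (by linarith [LL_nonneg (q₀ := q₀) h.M0.le])] at this

lemma ww_cont (h : Sol Ω A q₀ M q u) (h' : Sol Ω A q₀ M qt v) :
    ContinuousOn (ww q qt u v) (closure Ω) := by
  obtain ⟨K, _, hK⟩ := h.qlip
  obtain ⟨K', _, hK'⟩ := h'.qlip
  exact (hK.continuousOn.sqrt.mul h.uc.abs).sub (hK'.continuousOn.sqrt.mul h'.uc.abs)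

lemma ww_ae_diff (h : Sol Ω A q₀ M q u) (h' : Sol Ω A q₀ M qt v) (hE : Ell Ω A lam Lam) :
    ∀ᵐ x ∂(volume.restrict Ω), DifferentiableAt ℝ (ww q qt u v) x := by
  rw [ae_restrict_iff' hE.op.measurableSet, ae_iff]
  apply measure_null_of_locally_null
  intro x hx
  have hxΩ : x ∈ Ω := by
    by_contra hc
    exact hx (fun hh => absurd hh hc)
  obtain ⟨r, hr, hb⟩ := Metric.isOpen_iff.1 hE.op x hxΩ
  refine ⟨_, inter_mem_nhdsWithin _ (ball_mem_nhds x hr), ?_⟩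
  have := (ww_lip h h' hE hb).ae_differentiableWithinAt_of_mem (μ := volume)
  rw [ae_iff] at this
  refine measure_mono_null ?_ this
  rintro y ⟨hy, hyb⟩ hc
  exact hy (fun _ => (hc hyb).differentiableAt (isOpen_ball.mem_nhds hyb))

lemma ww_zero (hq : ∀ x ∈ frontier Ω, q x = qt x) (hu : ∀ x ∈ frontier Ω, u x = v x) :
    ∀ x ∈ frontier Ω, ww q qt u v x = 0 := by
  intro x hx
  simp [ww, hq x hx, hu x hx]

lemma ww_le (h : Sol Ω A q₀ M q u) (h' : Sol Ω A q₀ M qt v) {x} (hx : x ∈ Ω) :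
    |ww q qt u v x| ≤ 2 * (Real.sqrt M * M) := by
  have key : ∀ {q u : EuclideanSpace ℝ (Fin n) → ℝ}, Sol Ω A q₀ M q u →
      abs (Real.sqrt (q x) * |u x|) ≤ Real.sqrt M * M := by
    intro q u h
    have hxc := subset_closure hx
    rw [abs_mul, abs_abs, abs_of_nonneg (Real.sqrt_nonneg _)]
    exact mul_le_mul (Real.sqrt_le_sqrt (h.qhi x hxc)) (h.ub x hxc) (abs_nonneg _) (Real.sqrt_nonneg _)
  unfold ww
  refine (abs_sub _ _).trans ?_
  linarith [key h, key h']

/-- integrability of `|w| + ‖∇w‖` -/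
lemma ww_integ (h : Sol Ω A q₀ M q u) (h' : Sol Ω A q₀ M qt v) (hE : Ell Ω A lam Lam) :
    IntegrableOn (fun x => |ww q qt u v x|) Ω volume ∧
    IntegrableOn (fun x => ‖fderiv ℝ (ww q qt u v) x‖) Ω volume ∧
    IntegrableOn (fun x => (ww q qt u v x)^2 + ‖fderiv ℝ (ww q qt u v) x‖^2) Ω volume := by
  have hc : ContinuousOn (ww q qt u v) Ω := (ww_cont h h').mono subset_closure
  have hm : Measurable (fun x => ‖fderiv ℝ (ww q qt u v) x‖) := (measurable_fderiv ℝ _).norm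
  refine ⟨integ_of_cont hE hc.abs (B := 2 * (Real.sqrt M * M)) (fun x hx => by
      rw [abs_abs]; exact ww_le h h' hx), ?_, ?_⟩
  · refine Measure.integrableOn_of_bounded hE.bd.measure_lt_top.ne hm.aestronglyMeasurable
      (M := 2 * LL q₀ M) ?_
    refine (ae_restrict_iff' hE.op.measurableSet).2 (.of_forall fun x hx => ?_)
    rw [norm_norm]; exact ww_fderiv_le h h' hE hx
  · refine Integrable.add (integ_of_cont hE (hc.pow 2) (B := (2 * (Real.sqrt M * M))^2) ?_) ?_
    · intro x hx
      rw [abs_pow]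
      exact pow_le_pow_left₀ (abs_nonneg _) (ww_le h h' hx) 2
    · refine Measure.integrableOn_of_bounded hE.bd.measure_lt_top.ne
        (hm.pow_const 2).aestronglyMeasurable (M := (2 * LL q₀ M)^2) ?_
      refine (ae_restrict_iff' hE.op.measurableSet).2 (.of_forall fun x hx => ?_)
      rw [norm_pow, norm_norm]
      exact pow_le_pow_left₀ (norm_nonneg _) (ww_fderiv_le h h' hE hx) 2

end
section
variable {n : ℕ} {Ω : Set (EuclideanSpace ℝ (Fin n))}
    {A : Fin n → Fin n → EuclideanSpace ℝ (Fin n) → ℝ} {q₀ M lam Lam : ℝ}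
    {q qt u v : EuclideanSpace ℝ (Fin n) → ℝ}

lemma pd_mul {f g : EuclideanSpace ℝ (Fin n) → ℝ} {x} (i : Fin n) (hf : DifferentiableAt ℝ f x)
    (hg : DifferentiableAt ℝ g x) :
    pd i (fun y => f y * g y) x = f x * pd i g x + g x * pd i f x := by
  unfold pd
  rw [fderiv_fun_mul hf hg]
  simp

lemma pd_sub {f g : EuclideanSpace ℝ (Fin n) → ℝ} {x} (i : Fin n) (hf : DifferentiableAt ℝ f x)
    (hg : DifferentiableAt ℝ g x) :
    pd i (fun y => f y - g y) x = pd i f x - pd i g x := by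
  unfold pd
  rw [fderiv_fun_sub hf hg]
  simp

lemma pd_comp {f : EuclideanSpace ℝ (Fin n) → ℝ} {T : ℝ → ℝ} {T' : ℝ} {x} (i : Fin n)
    (hT : HasDerivAt T T' (f x)) (hf : DifferentiableAt ℝ f x) :
    pd i (fun y => T (f y)) x = T' * pd i f x := by
  unfold pd
  have := (hT.comp_hasFDerivAt x hf.hasFDerivAt).fderiv
  have e : (T ∘ f) = fun y => T (f y) := rfl
  rw [e] at this
  rw [this]
  simp

lemma pd_congr {f g : EuclideanSpace ℝ (Fin n) → ℝ} {x} (i : Fin n) (h : f =ᶠ[nhds x] g) :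
    pd i f x = pd i g x := by
  unfold pd
  rw [h.fderiv_eq]

lemma fderiv_dom {E : Type*} [NormedAddCommGroup E] [NormedSpace ℝ E] {g w : E → ℝ} {x : E}
    (hw : DifferentiableAt ℝ w x) (h : ∀ᶠ y in nhds x, |g y - g x| ≤ |w y - w x|) :
    ‖fderiv ℝ g x‖ ≤ ‖fderiv ℝ w x‖ := by
  by_cases hg : DifferentiableAt ℝ g x
  swap
  · rw [fderiv_zero_of_not_differentiableAt hg]; simp
  refine le_of_forall_pos_le_add fun η hη => ?_
  refine hg.hasFDerivAt.le_of_lip' (by positivity) ?_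
  have h2 := (hasFDerivAt_iff_isLittleO.1 hw.hasFDerivAt).def hη
  filter_upwards [h, h2] with y hy hy2
  rw [Real.norm_eq_abs]
  refine hy.trans ?_
  have h3 : |w y - w x| ≤ ‖w y - w x - (fderiv ℝ w x) (y - x)‖ + ‖fderiv ℝ w x (y - x)‖ := by
    have := norm_add_le (w y - w x - (fderiv ℝ w x) (y - x)) (fderiv ℝ w x (y - x))
    simpa using this
  have h4 := (fderiv ℝ w x).le_opNorm (y - x)
  linarith

lemma arctan_abs_le (x : ℝ) : |Real.arctan x| ≤ 2 := by
  have := Real.arctan_lt_pi_div_two x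
  have := Real.neg_pi_div_two_lt_arctan x
  have := Real.pi_lt_four
  rw [abs_le]; constructor <;> linarith

lemma arctan_hasDeriv (κ s : ℝ) :
    HasDerivAt (fun s => Real.arctan (κ * s)) (κ / (1 + (κ * s)^2)) s := by
  have h1 : HasDerivAt (fun s : ℝ => κ * s) κ s := by
    simpa using (hasDerivAt_id s).const_mul κ
  have h2 := (Real.hasDerivAt_arctan (κ * s)).comp s h1
  have e : (1 / (1 + (κ * s)^2) * κ) = κ / (1 + (κ * s)^2) := by ring
  rw [e] at h2
  exact h2

lemma arctan_k_contDiff (κ : ℝ) : ContDiff ℝ 1 (fun s => Real.arctan (κ * s)) :=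
  Real.contDiff_arctan.comp (contDiff_const.mul contDiff_id)

def C2 (n : ℕ) (Lam M : ℝ) : ℝ := 2 * M * M + n * (2 * (n * (Lam * M)))

lemma ibp2 {p z : EuclideanSpace ℝ (Fin n) → ℝ}
    (h : Sol Ω A q₀ M q u) (h' : Sol Ω A q₀ M qt v) (hE : Ell Ω A lam Lam)
    (hq : ∀ x ∈ frontier Ω, q x = qt x) (hu : ∀ x ∈ frontier Ω, u x = v x)
    (hz : Sol Ω A q₀ M p z) {κ : ℝ} (hκ : 0 < κ) :
    IntegrableOn (fun x => |ww q qt u v x| * (κ / (1 + (κ * z x)^2) * IP A z z x)) Ω volume ∧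
    ∫ x in Ω, |ww q qt u v x| * (κ / (1 + (κ * z x)^2) * IP A z z x) ≤
      C2 n Lam M * ∫ x in Ω, (|ww q qt u v x| + ‖fderiv ℝ (ww q qt u v) x‖) := by
  set w := ww q qt u v with hw
  set D : EuclideanSpace ℝ (Fin n) → ℝ := fun x => κ / (1 + (κ * z x)^2) * IP A z z x with hD
  set K : ℝ := n * (n * (Lam * M) * M) with hK
  have hM := h.M0
  have hLam := hE.Lpos
  have hK0 : 0 ≤ K := by positivity
  have hfin : IsFiniteMeasure (volume.restrict Ω) := ⟨by simpa using hE.bd.measure_lt_top⟩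
  obtain ⟨hi1, hi2, -⟩ := ww_integ h h' hE
  have hwc : ContinuousOn w (closure Ω) := ww_cont h h'
  have hzc : ContinuousOn z Ω := hz.uc.mono subset_closure
  have hDc : ContinuousOn D Ω := by
    refine ContinuousOn.mul (ContinuousOn.div continuousOn_const (by fun_prop) ?_) (hz.IP_cont hz hE)
    intro x _; positivity
  have hD0 : ∀ x ∈ Ω, 0 ≤ D x := fun x hx =>
    mul_nonneg (by positivity) (IP_nonneg hE hx)
  have hDle : ∀ x ∈ Ω, D x ≤ κ * K := fun x hx => by
    have a1 : κ / (1 + (κ * z x)^2) ≤ κ := div_le_self hκ.le (by nlinarith [sq_nonneg (κ * z x)])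
    have a2 := (le_abs_self _).trans (hz.IP_le hz hE hx)
    exact mul_le_mul a1 a2 (IP_nonneg hE hx) hκ.le
  have hitg : IntegrableOn (fun x => |w x| * D x) Ω volume := by
    refine integ_of_cont hE (((hwc.mono subset_closure).abs).mul hDc)
      (B := 2 * (Real.sqrt M * M) * (κ * K)) ?_
    intro x hx
    rw [abs_mul, abs_abs, abs_of_nonneg (hD0 x hx)]
    exact mul_le_mul (ww_le h h' hx) (hDle x hx) (hD0 x hx) (by positivity)
  refine ⟨hitg, ?_⟩
  set c := κ * K * (volume.restrict Ω).real univ with hc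
  have hc0 : 0 ≤ c := by positivity
  have key : ∀ δ > 0, ∫ x in Ω, |w x| * D x ≤
      C2 n Lam M * (∫ x in Ω, (|w x| + ‖fderiv ℝ w x‖)) + δ * c := by
    intro δ hδ
    set T : ℝ → ℝ := fun s => max (|s| - δ) 0 with hT
    have hTlip : LipschitzWith 1 T := by
      refine LipschitzWith.of_dist_le_mul fun a b => ?_
      rw [Real.dist_eq, Real.dist_eq, NNReal.coe_one, one_mul]
      refine (abs_max_sub_max_le_abs _ _ _).trans ?_
      have := abs_abs_sub_abs_le a b
      have e : |a| - δ - (|b| - δ) = |a| - |b| := by ring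
      rwa [e]
    have hT0 : ∀ s, |s| ≤ δ → T s = 0 := fun s hs => max_eq_right (by linarith)
    set f := Ω.indicator (fun x => T (w x)) with hf
    obtain ⟨hcs, hts⟩ := cutoff hE.op hE.bd hwc (ww_zero hq hu) hδ hT0
    have hfl := cutoff_lip hE.op hts (fun x hx => (ww_llip h h' hE hx).comp_lip hTlip)
    set G : Fin n → EuclideanSpace ℝ (Fin n) → ℝ := fun i y =>
      Real.arctan (κ * z y) * flux A z i y with hG
    have hβ : ContDiffOn ℝ 1 (fun y => Real.arctan (κ * z y)) Ω :=
      (arctan_k_contDiff κ).comp_contDiffOn hz.u1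
    have hGc : ∀ i, ContDiffOn ℝ 1 (G i) Ω := fun i => hβ.mul (hz.flux_c1 hE i)
    obtain ⟨hI, hI0⟩ := ibp_div hE.op hfl hcs hts hGc
    have hpt : ∀ᵐ x ∂(volume.restrict Ω), |w x| * D x ≤
        (∑ i, (f x * pd i (G i) x + G i x * pd i f x)) +
        C2 n Lam M * (|w x| + ‖fderiv ℝ w x‖) + δ * (κ * K) := by
      filter_upwards [ww_ae_diff h h' hE, ae_restrict_mem hE.op.measurableSet] with x hxd hx
      have hfx : f x = T (w x) := indicator_of_mem hx _
      have hf0 : 0 ≤ f x := by rw [hfx]; exact le_max_right _ _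
      have hf1 : |w x| ≤ f x + δ := by
        rw [hfx]; have := le_max_left (|w x| - δ) 0
        simp only [hT]; linarith
      have hf2 : f x ≤ |w x| := by
        rw [hfx]; exact max_le (by linarith) (abs_nonneg _)
      have hfd : ∀ i, |pd i f x| ≤ ‖fderiv ℝ w x‖ := fun i => by
        refine (abs_pd_le _ _ _).trans (fderiv_dom hxd ?_)
        filter_upwards [hE.op.mem_nhds hx] with y hy
        have : f y = T (w y) := indicator_of_mem hy _
        rw [hfx, this]
        simpa [Real.dist_eq] using hTlip.dist_le_mul (w y) (w x)
      have hpdG : ∀ i, pd i (G i) x = Real.arctan (κ * z x) * pd i (flux A z i) x +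
          flux A z i x * (κ / (1 + (κ * z x)^2) * pd i z x) := fun i => by
        have d1 := (hβ.contDiffAt (hE.op.mem_nhds hx)).differentiableAt (by norm_num)
        have d2 := ((hz.flux_c1 hE i).contDiffAt (hE.op.mem_nhds hx)).differentiableAt (by norm_num)
        have := pd_mul i d1 d2
        have e2 := pd_comp (f := z) i (arctan_hasDeriv κ (z x)) (hz.diff hE hx)
        rw [← e2]; exact this
      have hsum : (∑ i, (f x * pd i (G i) x + G i x * pd i f x)) =
          f x * (Real.arctan (κ * z x) * (-(p x * z x)) + D x) +
          Real.arctan (κ * z x) * ∑ i, flux A z i x * pd i f x := by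
        rw [← hz.flux_div hE hx]
        simp only [hpdG]
        simp only [hD, IP, hG, Finset.mul_sum, mul_add (f x), ← Finset.sum_add_distrib]
        refine Finset.sum_congr rfl fun i _ => by ring
      have hxc := subset_closure hx
      have b1 : |f x * (Real.arctan (κ * z x) * (-(p x * z x)))| ≤ |w x| * (2 * (M * M)) := by
        rw [abs_mul, abs_of_nonneg hf0, abs_mul, abs_neg, abs_mul]
        have hp0 : 0 ≤ p x := hz.q0.le.trans (hz.qlo x hxc)
        have := arctan_abs_le (κ * z x)
        have := hz.qhi x hxc
        have := hz.ub x hxc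
        rw [abs_of_nonneg hp0]
        gcongr
      have b2 : |Real.arctan (κ * z x) * ∑ i, flux A z i x * pd i f x| ≤
          2 * (n * (n * (Lam * M) * ‖fderiv ℝ w x‖)) := by
        rw [abs_mul]
        have s1 : |∑ i, flux A z i x * pd i f x| ≤ n * (n * (Lam * M) * ‖fderiv ℝ w x‖) := by
          refine (Finset.abs_sum_le_sum_abs _ _).trans ?_
          calc ∑ j, |flux A z j x * pd j f x| ≤ ∑ j : Fin n, n * (Lam * M) * ‖fderiv ℝ w x‖ := by
                apply Finset.sum_le_sum; intro j _
                rw [abs_mul]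
                exact mul_le_mul (hz.flux_le hE hx j) (hfd j) (abs_nonneg _) (by positivity)
            _ = _ := by simp
        exact mul_le_mul (arctan_abs_le _) s1 (abs_nonneg _) (by norm_num)
      have b3 : |w x| * D x ≤ f x * D x + δ * (κ * K) := by
        have := mul_le_mul_of_nonneg_right hf1 (hD0 x hx)
        have := mul_le_mul_of_nonneg_left (hDle x hx) hδ.le
        linarith
      rw [hsum]
      have c1 := (abs_le.1 b1).1
      have c2 := (abs_le.1 b2).1
      have e1 : C2 n Lam M * (|w x| + ‖fderiv ℝ w x‖) =
        |w x| * (2 * (M * M)) + 2 * (n * (n * (Lam * M) * ‖fderiv ℝ w x‖)) +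
        (n * (2 * (n * (Lam * M))) * |w x| + 2 * M * M * ‖fderiv ℝ w x‖) := by unfold C2; ring
      have e2 : 0 ≤ n * (2 * (n * (Lam * M))) * |w x| + 2 * M * M * ‖fderiv ℝ w x‖ := by positivity
      rw [e1, mul_add (f x)]
      linarith
    have hI2 : Integrable (fun x => C2 n Lam M * (|w x| + ‖fderiv ℝ w x‖)) (volume.restrict Ω) :=
      (hi1.add hi2).const_mul _
    have hI12 := hI.add hI2
    calc ∫ x in Ω, |w x| * D x ≤ ∫ x in Ω, ((∑ i, (f x * pd i (G i) x + G i x * pd i f x)) +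
        C2 n Lam M * (|w x| + ‖fderiv ℝ w x‖) + δ * (κ * K)) :=
          integral_mono_ae hitg (hI12.add (integrable_const _)) hpt
      _ = _ := by
        have e1 := integral_add hI12 (integrable_const (δ * (κ * K)))
        have e2 := integral_add hI hI2
        simp only [Pi.add_apply] at e1 e2
        rw [e1, e2, hI0, integral_const_mul, integral_const, hc]
        simp only [smul_eq_mul]; ring
  refine le_of_forall_pos_le_add fun η hη => ?_
  have := key (η / (c + 1)) (by positivity)
  refine this.trans ?_
  have : η / (c + 1) * c ≤ η := by
    rw [div_mul_eq_mul_div, div_le_iff₀ (by positivity)]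
    nlinarith
  linarith

end
def PhiR (κ a b : ℝ) : ℝ :=
  Real.arctan (κ * a) * Real.arctan (κ * b) * (a^2 - b^2) / (a^2 + b^2 + κ⁻¹)

def PsiR (κ σ a b gg gp pp : ℝ) : ℝ :=
  4 * tau κ⁻¹ (PhiR κ a b) * (a * b * Real.arctan (κ * a) * Real.arctan (κ * b)) *
      (b^2 * gg - 2 * a * b * gp + a^2 * pp) / (a^2 + b^2 + κ⁻¹)^2
    + 4 * σ^2 * (a * b * Real.arctan (κ * a) * Real.arctan (κ * b)) / (a^2 + b^2 + κ⁻¹) * (|a| - |b|)^2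

def ErrR (κ K c c' a b : ℝ) : ℝ :=
  16 * K * (κ⁻¹ * (a^2 + b^2) / (a^2 + b^2 + κ⁻¹)^2)
    + c * (|a| * (κ / (1 + (κ * a)^2)) + |b| * (κ / (1 + (κ * b)^2))) + c' * κ⁻¹

lemma PhiR_line {κ : ℝ} (hκ : 0 < κ) {a b : ℝ → ℝ} {ga gb t : ℝ} (ha : HasDerivAt a ga t)
    (hb : HasDerivAt b gb t) :
    HasDerivAt (fun t => PhiR κ (a t) (b t))
      (((κ / (1 + (κ * a t)^2)) * Real.arctan (κ * b t) * (((a t)^2 - (b t)^2) / ((a t)^2 + (b t)^2 + κ⁻¹))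
        + Real.arctan (κ * a t) * Real.arctan (κ * b t) *
          (2 * a t * (2 * (b t)^2 + κ⁻¹)) / ((a t)^2 + (b t)^2 + κ⁻¹)^2) * ga
      + ((κ / (1 + (κ * b t)^2)) * Real.arctan (κ * a t) * (((a t)^2 - (b t)^2) / ((a t)^2 + (b t)^2 + κ⁻¹))
        - Real.arctan (κ * a t) * Real.arctan (κ * b t) *
          (2 * b t * (2 * (a t)^2 + κ⁻¹)) / ((a t)^2 + (b t)^2 + κ⁻¹)^2) * gb) t := by
  have hpos : 0 < (a t)^2 + (b t)^2 + κ⁻¹ := by positivity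
  have h1 := (arctan_hasDeriv κ (a t)).comp t ha
  have h2 := (arctan_hasDeriv κ (b t)).comp t hb
  have h3 := ((h1.mul h2).mul ((ha.pow 2).sub (hb.pow 2))).div
    (((ha.pow 2).add (hb.pow 2)).add_const κ⁻¹) hpos.ne'
  refine h3.congr_deriv ?_
  simp only [Function.comp_apply, Pi.mul_apply, Pi.pow_apply, Pi.sub_apply, Pi.add_apply]
  have e1 : 0 < 1 + (κ * a t)^2 := by positivity
  have e2 : 0 < 1 + (κ * b t)^2 := by positivity
  generalize κ / (1 + (κ * a t)^2) = d1
  generalize κ / (1 + (κ * b t)^2) = d2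
  generalize κ⁻¹ = ε at *
  generalize Real.arctan (κ * a t) = bu
  generalize Real.arctan (κ * b t) = bv
  field_simp
  push_cast
  ring

section
variable {n : ℕ} {Ω : Set (EuclideanSpace ℝ (Fin n))}
    {A : Fin n → Fin n → EuclideanSpace ℝ (Fin n) → ℝ} {q₀ M lam Lam : ℝ}
    {q qt u v : EuclideanSpace ℝ (Fin n) → ℝ}

lemma PhiR_contDiff {κ : ℝ} (hκ : 0 < κ) (hu : ContDiffOn ℝ 1 u Ω) (hv : ContDiffOn ℝ 1 v Ω) :
    ContDiffOn ℝ 1 (fun y => PhiR κ (u y) (v y)) Ω := by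
  unfold PhiR
  refine ContDiffOn.div ?_ (((hu.pow 2).add (hv.pow 2)).add contDiffOn_const) ?_
  · exact (((arctan_k_contDiff κ).comp_contDiffOn hu).mul
      ((arctan_k_contDiff κ).comp_contDiffOn hv)).mul ((hu.pow 2).sub (hv.pow 2))
  · intro x _; positivity

lemma PhiR_cont {κ : ℝ} (hκ : 0 < κ) {D : Set (EuclideanSpace ℝ (Fin n))}
    (hu : ContinuousOn u D) (hv : ContinuousOn v D) :
    ContinuousOn (fun y => PhiR κ (u y) (v y)) D := by
  unfold PhiR
  refine ContinuousOn.div ?_ (((hu.pow 2).add (hv.pow 2)).add continuousOn_const) ?_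
  · exact ((Real.continuous_arctan.comp_continuousOn (continuousOn_const.mul hu)).mul
      (Real.continuous_arctan.comp_continuousOn (continuousOn_const.mul hv))).mul ((hu.pow 2).sub (hv.pow 2))
  · intro x _; positivity

lemma line_of_diff {f : EuclideanSpace ℝ (Fin n) → ℝ} {x} (hf : DifferentiableAt ℝ f x) (i : Fin n) :
    HasDerivAt (fun t : ℝ => f (x + t • EuclideanSpace.single i (1:ℝ))) (pd i f x) 0 :=
  hf.hasFDerivAt.hasLineDerivAt _

lemma pd_PhiR {κ : ℝ} (hκ : 0 < κ) {x} (hu : ContDiffAt ℝ 1 u x) (hv : ContDiffAt ℝ 1 v x)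
    (i : Fin n) : pd i (fun y => PhiR κ (u y) (v y)) x =
      ((κ / (1 + (κ * u x)^2)) * Real.arctan (κ * v x) * (((u x)^2 - (v x)^2) / ((u x)^2 + (v x)^2 + κ⁻¹))
        + Real.arctan (κ * u x) * Real.arctan (κ * v x) *
          (2 * u x * (2 * (v x)^2 + κ⁻¹)) / ((u x)^2 + (v x)^2 + κ⁻¹)^2) * pd i u x
      + ((κ / (1 + (κ * v x)^2)) * Real.arctan (κ * u x) * (((u x)^2 - (v x)^2) / ((u x)^2 + (v x)^2 + κ⁻¹))
        - Real.arctan (κ * u x) * Real.arctan (κ * v x) *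
          (2 * v x * (2 * (u x)^2 + κ⁻¹)) / ((u x)^2 + (v x)^2 + κ⁻¹)^2) * pd i v x := by
  have hd : DifferentiableAt ℝ (fun y => PhiR κ (u y) (v y)) x := by
    have hpos : (u x)^2 + (v x)^2 + κ⁻¹ ≠ 0 := by positivity
    have d1 : ContDiffAt ℝ 1 (fun y => Real.arctan (κ * u y) * Real.arctan (κ * v y) *
        ((u y)^2 - (v y)^2)) x :=
      (((arctan_k_contDiff κ).contDiffAt.comp x hu).mul
        ((arctan_k_contDiff κ).contDiffAt.comp x hv)).mul ((hu.pow 2).sub (hv.pow 2))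
    have d2 : ContDiffAt ℝ 1 (fun y => (u y)^2 + (v y)^2 + κ⁻¹) x :=
      ((hu.pow 2).add (hv.pow 2)).add contDiffAt_const
    exact (d1.div d2 hpos).differentiableAt (by norm_num)
  have h1 := line_of_diff hd i
  have h2 := PhiR_line hκ (line_of_diff (hu.differentiableAt (by norm_num)) i)
    (line_of_diff (hv.differentiableAt (by norm_num)) i)
  simp only [zero_smul, add_zero] at h2
  exact h1.unique h2


lemma WdivPhi (h : Sol Ω A q₀ M q u) (h' : Sol Ω A q₀ M qt v)
    (hE : Ell Ω A lam Lam) {x} (hx : x ∈ Ω) :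
    (∑ i, pd i (fun y => v y * flux A u i y - u y * flux A v i y) x) = u x * v x * (qt x - q x) := by
  have e : ∀ i, pd i (fun y => v y * flux A u i y - u y * flux A v i y) x =
      (v x * pd i (flux A u i) x + flux A u i x * pd i v x) -
      (u x * pd i (flux A v i) x + flux A v i x * pd i u x) := fun i => by
    have d1 := ((h.flux_c1 hE i).contDiffAt (hE.op.mem_nhds hx)).differentiableAt (by norm_num)
    have d2 := ((h'.flux_c1 hE i).contDiffAt (hE.op.mem_nhds hx)).differentiableAt (by norm_num)
    rw [pd_sub i ((h'.diff hE hx).fun_mul d1) ((h.diff hE hx).fun_mul d2),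
      pd_mul i (h'.diff hE hx) d1, pd_mul i (h.diff hE hx) d2]
  simp only [e, Finset.sum_sub_distrib, Finset.sum_add_distrib, ← Finset.mul_sum]
  rw [h.flux_div hE hx, h'.flux_div hE hx]
  have := IP_symm (u := u) (v := v) hE hx
  unfold IP at this
  rw [this]
  ring

lemma ibp1_sum {κ : ℝ} (hκ : 0 < κ) (h : Sol Ω A q₀ M q u) (h' : Sol Ω A q₀ M qt v)
    (hE : Ell Ω A lam Lam) {x} (hx : x ∈ Ω) :
    (∑ i, ((Ω.indicator (fun y => TT κ⁻¹ (PhiR κ (u y) (v y)))) x *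
        pd i (fun y => v y * flux A u i y - u y * flux A v i y) x +
        (v x * flux A u i x - u x * flux A v i x) *
        pd i (Ω.indicator (fun y => TT κ⁻¹ (PhiR κ (u y) (v y)))) x)) =
    TT κ⁻¹ (PhiR κ (u x) (v x)) * (u x * v x * (Real.sqrt (qt x)^2 - Real.sqrt (q x)^2)) +
      tau κ⁻¹ (PhiR κ (u x) (v x)) * (Real.arctan (κ * u x) * Real.arctan (κ * v x) *
        (4 * u x * v x * ((v x)^2 * IP A u u x - 2 * u x * v x * IP A u v x + (u x)^2 * IP A v v x)
              + κ⁻¹ * (2 * u x * v x * (IP A u u x + IP A v v x) - 2 * ((u x)^2 + (v x)^2) * IP A u v x))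
               / ((u x)^2 + (v x)^2 + κ⁻¹)^2
          + ((u x)^2 - (v x)^2) / ((u x)^2 + (v x)^2 + κ⁻¹) *
            (v x * Real.arctan (κ * v x) * (κ / (1 + (κ * u x)^2)) * IP A u u x
            - u x * Real.arctan (κ * u x) * (κ / (1 + (κ * v x)^2)) * IP A v v x
            + (v x * (κ / (1 + (κ * v x)^2)) * Real.arctan (κ * u x)
              - u x * (κ / (1 + (κ * u x)^2)) * Real.arctan (κ * v x)) * IP A u v x)) := by
  have hxc := subset_closure hx
  have hnx := hE.op.mem_nhds hx
  rw [Real.sq_sqrt (h.q0.le.trans (h.qlo x hxc)), Real.sq_sqrt (h'.q0.le.trans (h'.qlo x hxc))]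
  rw [Finset.sum_add_distrib, ← Finset.mul_sum, WdivPhi h h' hE hx, indicator_of_mem hx]
  congr 1
  have hpd : ∀ i, pd i (Ω.indicator (fun y => TT κ⁻¹ (PhiR κ (u y) (v y)))) x =
      tau κ⁻¹ (PhiR κ (u x) (v x)) * pd i (fun y => PhiR κ (u y) (v y)) x := fun i => by
    have e : Ω.indicator (fun y => TT κ⁻¹ (PhiR κ (u y) (v y))) =ᶠ[nhds x]
        (fun y => TT κ⁻¹ (PhiR κ (u y) (v y))) := by
      filter_upwards [hnx] with y hy
      exact indicator_of_mem hy _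
    rw [pd_congr i e]
    exact pd_comp (f := fun y => PhiR κ (u y) (v y)) i (TT_hasDerivAt _ _)
      (((PhiR_contDiff hκ h.u1 h'.u1).contDiffAt hnx).differentiableAt (by norm_num))
  simp only [hpd, pd_PhiR hκ (h.u1.contDiffAt hnx) (h'.u1.contDiffAt hnx)]
  set Pa := (κ / (1 + (κ * u x)^2)) * Real.arctan (κ * v x) * (((u x)^2 - (v x)^2) / ((u x)^2 + (v x)^2 + κ⁻¹))
        + Real.arctan (κ * u x) * Real.arctan (κ * v x) *
          (2 * u x * (2 * (v x)^2 + κ⁻¹)) / ((u x)^2 + (v x)^2 + κ⁻¹)^2 with hPa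
  set Pb := (κ / (1 + (κ * v x)^2)) * Real.arctan (κ * u x) * (((u x)^2 - (v x)^2) / ((u x)^2 + (v x)^2 + κ⁻¹))
        - Real.arctan (κ * u x) * Real.arctan (κ * v x) *
          (2 * v x * (2 * (u x)^2 + κ⁻¹)) / ((u x)^2 + (v x)^2 + κ⁻¹)^2 with hPb
  have e : (∑ i, (v x * flux A u i x - u x * flux A v i x) *
      (tau κ⁻¹ (PhiR κ (u x) (v x)) * (Pa * pd i u x + Pb * pd i v x))) =
      tau κ⁻¹ (PhiR κ (u x) (v x)) * (Pa * (v x * IP A u u x - u x * IP A u v x)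
        + Pb * (v x * IP A v u x - u x * IP A v v x)) := by
    simp only [IP, Finset.mul_sum, ← Finset.sum_add_distrib, ← Finset.sum_sub_distrib]
    refine Finset.sum_congr rfl fun i _ => by ring
  rw [e, IP_symm hE hx (u := v) (v := u), hPa, hPb]
  congr 1
  ring

end
lemma psi_aux {K a b gg gp pp : ℝ} (h1 : |gg| ≤ K) (h2 : |gp| ≤ K) (h3 : |pp| ≤ K) :
    |b^2 * gg - 2 * a * b * gp + a^2 * pp| ≤ 2 * K * (a^2 + b^2) := by
  have e1 : |b^2 * gg| ≤ b^2 * K := by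
    rw [abs_mul, abs_of_nonneg (sq_nonneg b)]; gcongr
  have e3 : |a^2 * pp| ≤ a^2 * K := by
    rw [abs_mul, abs_of_nonneg (sq_nonneg a)]; gcongr
  have hK : 0 ≤ K := (abs_nonneg _).trans h1
  have e2 : |2 * a * b * gp| ≤ (a^2 + b^2) * K := by
    rw [abs_mul]
    have : |2 * a * b| ≤ a^2 + b^2 := by
      rw [abs_le]; constructor <;> nlinarith [sq_nonneg (a + b), sq_nonneg (a - b)]
    exact mul_le_mul this h2 (abs_nonneg _) (by positivity)
  have := abs_le.1 e1
  have := abs_le.1 e2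
  have := abs_le.1 e3
  rw [abs_le]; constructor <;> linarith

lemma psi_bound {κ σ M K a b gg gp pp : ℝ} (hκ : 0 < κ) (ha : |a| ≤ M) (hb : |b| ≤ M)
    (h1 : |gg| ≤ K) (h2 : |gp| ≤ K) (h3 : |pp| ≤ K) :
    |PsiR κ σ a b gg gp pp| ≤ 16 * K + 8 * σ^2 * M^2 := by
  have hK : 0 ≤ K := (abs_nonneg _).trans h1
  have hM : 0 ≤ M := (abs_nonneg _).trans ha
  have hN := psi_aux (a := a) (b := b) h1 h2 h3
  set N := b^2 * gg - 2 * a * b * gp + a^2 * pp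
  have hR : 0 ≤ a^2 + b^2 := by positivity
  have hp : 0 < a^2 + b^2 + κ⁻¹ := by positivity
  have hκ' : 0 < κ⁻¹ := by positivity
  have hq : |a * b * Real.arctan (κ * a) * Real.arctan (κ * b)| ≤ 2 * (a^2 + b^2) := by
    rw [abs_mul, abs_mul]
    have e : |a * b| ≤ (a^2 + b^2) / 2 := by
      rw [abs_le]; constructor <;> nlinarith [sq_nonneg (a + b), sq_nonneg (a - b)]
    calc _ ≤ (a^2 + b^2) / 2 * 2 * 2 := by
          have := arctan_abs_le (κ * a)
          have := arctan_abs_le (κ * b)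
          gcongr
      _ = _ := by ring
  set Q := a * b * Real.arctan (κ * a) * Real.arctan (κ * b)
  have hτ : |tau κ⁻¹ (PhiR κ a b)| ≤ 1 := by
    rw [abs_of_nonneg (tau_nonneg _ _)]; exact tau_le_one _ _
  unfold PsiR
  refine (abs_add_le _ _).trans (add_le_add ?_ ?_)
  · rw [abs_div, abs_of_pos (by positivity : 0 < (a^2 + b^2 + κ⁻¹)^2), div_le_iff₀ (by positivity),
      abs_mul, abs_mul, abs_mul, abs_of_nonneg (by norm_num : (0:ℝ) ≤ 4)]
    calc 4 * |tau κ⁻¹ (PhiR κ a b)| * |Q| * |N| ≤ 4 * 1 * (2 * (a^2 + b^2)) * (2 * K * (a^2 + b^2)) := by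
          gcongr
      _ = 16 * K * (a^2 + b^2)^2 := by ring
      _ ≤ _ := mul_le_mul_of_nonneg_left (pow_le_pow_left₀ hR (by linarith) 2) (by positivity)
  · rw [abs_mul, abs_div, abs_of_pos hp, abs_mul, abs_of_nonneg (by positivity : 0 ≤ 4 * σ^2), abs_pow]
    have e1 : 4 * σ^2 * |Q| / (a^2 + b^2 + κ⁻¹) ≤ 8 * σ^2 := by
      rw [div_le_iff₀ hp]
      nlinarith [mul_le_mul_of_nonneg_left hq (by positivity : 0 ≤ 4 * σ^2), mul_nonneg (sq_nonneg σ) hκ'.le]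
    have e2 : abs (|a| - |b|) ≤ M := by
      rw [abs_le]; constructor <;> linarith [abs_nonneg a, abs_nonneg b]
    gcongr

lemma err_aux (κ a : ℝ) : |a| * (κ / (1 + (κ * a)^2)) ≤ 1 := by
  rw [mul_div_assoc', div_le_one (by positivity)]
  have e : (κ * a)^2 = (κ * |a|)^2 := by rw [mul_pow, mul_pow, sq_abs]
  rw [e]
  nlinarith [sq_nonneg (κ * |a| - 1), sq_nonneg (κ * |a|)]

lemma err_bound {κ K c c' a b : ℝ} (hκ : 1 ≤ κ) (hK : 0 ≤ K) (hc : 0 ≤ c) (hc' : 0 ≤ c') :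
    |ErrR κ K c c' a b| ≤ 16 * K + 2 * c + c' := by
  have hκ0 : 0 < κ := by linarith
  have hκ' : 0 < κ⁻¹ := by positivity
  have hR : 0 ≤ a^2 + b^2 := by positivity
  unfold ErrR
  rw [abs_of_nonneg (by positivity)]
  have e1 : κ⁻¹ * (a^2 + b^2) / (a^2 + b^2 + κ⁻¹)^2 ≤ 1 := by
    rw [div_le_one (by positivity)]
    nlinarith [mul_nonneg hR hκ'.le]
  have e2 := err_aux κ a
  have e3 := err_aux κ b
  have e4 : κ⁻¹ ≤ 1 := inv_le_one_of_one_le₀ hκ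
  nlinarith [mul_le_mul_of_nonneg_left e1 hK, mul_le_mul_of_nonneg_left e2 hc,
    mul_le_mul_of_nonneg_left e3 hc, mul_le_mul_of_nonneg_left e4 hc']

open Filter Topology in
lemma kk_tendsto : Tendsto (fun k : ℕ => ((k:ℝ) + 1)) atTop atTop :=
  tendsto_atTop_add_const_right _ _ tendsto_natCast_atTop_atTop

open Filter Topology in
lemma err_tendsto1 (a : ℝ) :
    Tendsto (fun κ : ℝ => |a| * (κ / (1 + (κ * a)^2))) atTop (𝓝 0) := by
  by_cases ha : a = 0
  · simp [ha]
  have ha' : 0 < |a| := abs_pos.2 ha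
  refine squeeze_zero' (g := fun κ => |a|⁻¹ * κ⁻¹) ?_ ?_ ?_
  · filter_upwards [eventually_gt_atTop 0] with κ hκ
    positivity
  · filter_upwards [eventually_gt_atTop 0] with κ hκ
    have e : (κ * a)^2 = (κ * |a|)^2 := by rw [mul_pow, mul_pow, sq_abs]
    rw [e, mul_div_assoc', ← mul_inv, ← one_div, div_le_div_iff₀ (by positivity) (by positivity)]
    nlinarith
  · simpa using tendsto_inv_atTop_zero.const_mul (|a|⁻¹)

open Filter Topology in
lemma err_tendsto (K c c' a b : ℝ) :
    Tendsto (fun κ : ℝ => ErrR κ K c c' a b) atTop (𝓝 0) := by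
  have hinv : Tendsto (fun κ : ℝ => κ⁻¹) atTop (𝓝 0) := tendsto_inv_atTop_zero
  have h1 : Tendsto (fun κ : ℝ => κ⁻¹ * (a^2 + b^2) / (a^2 + b^2 + κ⁻¹)^2) atTop (𝓝 0) := by
    by_cases hR : a^2 + b^2 = 0
    · simp [hR]
    have := (hinv.mul_const (a^2 + b^2)).div (((hinv.const_add (a^2+b^2))).pow 2) (by simpa using hR)
    simp only [zero_mul, zero_div] at this
    exact this
  have := ((h1.const_mul (16 * K)).add (((err_tendsto1 a).add (err_tendsto1 b)).const_mul c)).add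
    (hinv.const_mul c')
  simpa [ErrR] using this

def PsiLim (σ a b gg gp pp : ℝ) : ℝ :=
  if a^2 = b^2 then 0 else
    Real.pi^2 * (|a * b| * (b^2 * gg - 2 * a * b * gp + a^2 * pp) / (a^2 + b^2)^2
      + σ^2 * |a * b| / (a^2 + b^2) * (|a| - |b|)^2)

open Filter Topology in
lemma arctan_tendsto {a : ℝ} :
    Tendsto (fun κ : ℝ => a * Real.arctan (κ * a)) atTop (𝓝 (|a| * (Real.pi / 2))) := by
  rcases lt_trichotomy a 0 with h | h | h
  · have h1 : Tendsto (fun κ : ℝ => κ * a) atTop atBot := tendsto_id.atTop_mul_const_of_neg h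
    have h2 := (Real.tendsto_arctan_atBot.mono_right nhdsWithin_le_nhds).comp h1
    have := h2.const_mul a
    rw [abs_of_neg h]
    have e : -a * (Real.pi / 2) = a * -(Real.pi / 2) := by ring
    rw [e]
    exact this
  · simp [h]
  · have h1 : Tendsto (fun κ : ℝ => κ * a) atTop atTop := tendsto_id.atTop_mul_const h
    have h2 := (Real.tendsto_arctan_atTop.mono_right nhdsWithin_le_nhds).comp h1
    rw [abs_of_pos h]
    exact h2.const_mul a

open Filter Topology in
lemma psi_tendsto (σ a b gg gp pp : ℝ) :
    Tendsto (fun κ : ℝ => PsiR κ σ a b gg gp pp) atTop (𝓝 (PsiLim σ a b gg gp pp)) := by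
  unfold PsiLim
  split_ifs with hab
  · have hab' : |a| = |b| := by
      rw [← sq_abs a, ← sq_abs b] at hab
      exact (pow_left_inj₀ (abs_nonneg _) (abs_nonneg _) (by norm_num)).1 hab
    refine tendsto_const_nhds.congr' ?_
    filter_upwards [eventually_gt_atTop 0] with κ hκ
    have : tau κ⁻¹ (PhiR κ a b) = 0 := by
      apply tau_eq_zero (by positivity)
      simp only [PhiR, hab, sub_self, mul_zero, zero_div, abs_zero]
      positivity
    simp [PsiR, this, hab']
  have hR : a^2 + b^2 ≠ 0 := by
    intro h0
    apply hab
    nlinarith [sq_nonneg a, sq_nonneg b]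
  have hinv : Tendsto (fun κ : ℝ => κ⁻¹) atTop (𝓝 0) := tendsto_inv_atTop_zero
  have hden : Tendsto (fun κ : ℝ => a^2 + b^2 + κ⁻¹) atTop (𝓝 (a^2+b^2)) := by
    simpa using hinv.const_add (a^2+b^2)
  have hQ : Tendsto (fun κ : ℝ => a * b * Real.arctan (κ * a) * Real.arctan (κ * b)) atTop
      (𝓝 (|a * b| * (Real.pi / 2)^2)) := by
    have := (arctan_tendsto (a := a)).mul (arctan_tendsto (a := b))
    rw [abs_mul]
    convert this using 2 <;> ring
  by_cases h0 : a * b = 0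
  · simp [PsiR, h0]
  have hτ : ∀ᶠ κ in atTop, tau κ⁻¹ (PhiR κ a b) = 1 := by
    have h1 : Tendsto (fun κ : ℝ => abs (a * b * PhiR κ a b)) atTop
        (𝓝 (abs (|a * b| * (Real.pi / 2)^2 * (a^2 - b^2) / (a^2 + b^2)))) := by
      have := ((hQ.mul_const (a^2 - b^2)).div hden hR).abs
      convert this using 2
      simp only [PhiR, Pi.div_apply]; ring_nf
    have hpos : 0 < abs (|a * b| * (Real.pi / 2)^2 * (a^2 - b^2) / (a^2 + b^2)) := by
      have := Real.pi_pos.ne'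
      have : a^2 - b^2 ≠ 0 := sub_ne_zero.2 hab
      have : |a * b| ≠ 0 := abs_ne_zero.2 h0
      positivity
    have h2 : Tendsto (fun κ : ℝ => |a * b| * (2 * κ⁻¹)) atTop (𝓝 0) := by
      simpa using (hinv.const_mul 2).const_mul (|a * b|)
    filter_upwards [h2.eventually_lt h1 hpos, eventually_gt_atTop 0] with κ hκ hκ0
    apply tau_eq_one (by positivity)
    rw [abs_mul (a * b)] at hκ
    exact (lt_of_mul_lt_mul_left hκ (abs_nonneg _)).le
  have h3 := (((hQ.const_mul 4).mul_const (b^2 * gg - 2 * a * b * gp + a^2 * pp)).div (hden.pow 2)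
    (pow_ne_zero 2 hR)).add (((hQ.const_mul (4 * σ^2)).div hden hR).mul_const ((|a| - |b|)^2))
  refine (h3.congr' ?_).trans (le_of_eq ?_)
  · filter_upwards [hτ] with κ hκ
    simp only [PsiR, hκ, Pi.div_apply, mul_one]
  · congr 1; ring
section
variable {n : ℕ} {Ω : Set (EuclideanSpace ℝ (Fin n))}
    {A : Fin n → Fin n → EuclideanSpace ℝ (Fin n) → ℝ} {q₀ M lam Lam : ℝ}
    {q qt u v : EuclideanSpace ℝ (Fin n) → ℝ}

def KK (n : ℕ) (Lam M : ℝ) : ℝ := n * (n * (Lam * M) * M)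

def c4 (n : ℕ) (Lam q₀ M : ℝ) : ℝ :=
  2 * KK n Lam M + 2 * Real.sqrt M * KK n Lam M / Real.sqrt q₀

def c5 (M : ℝ) : ℝ := 2 * M^2 * Real.sqrt M^2

def C3 (n : ℕ) (Lam q₀ M : ℝ) : ℝ :=
  8 * Real.sqrt M * M + 2 / Real.sqrt q₀ * (C2 n Lam M + C2 n Lam M)

def Psi (A : Fin n → Fin n → EuclideanSpace ℝ (Fin n) → ℝ) (q₀ κ : ℝ)
    (u v : EuclideanSpace ℝ (Fin n) → ℝ) (x : EuclideanSpace ℝ (Fin n)) : ℝ :=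
  PsiR κ (Real.sqrt q₀) (u x) (v x) (IP A u u x) (IP A u v x) (IP A v v x)

lemma Psi_cont {κ : ℝ} (hκ : 0 < κ) (h : Sol Ω A q₀ M q u) (h' : Sol Ω A q₀ M qt v)
    (hE : Ell Ω A lam Lam) : ContinuousOn (Psi A q₀ κ u v) Ω := by
  have hu : ContinuousOn u Ω := h.uc.mono subset_closure
  have hv : ContinuousOn v Ω := h'.uc.mono subset_closure
  have h1 : ContinuousOn (fun x => tau κ⁻¹ (PhiR κ (u x) (v x))) Ω :=
    (tau_cont _).comp_continuousOn (PhiR_cont hκ hu hv)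
  have h2 := h.IP_cont h hE
  have h3 := h.IP_cont h' hE
  have h4 := h'.IP_cont h' hE
  have h5 : ContinuousOn (fun x => Real.arctan (κ * u x)) Ω :=
    Real.continuous_arctan.comp_continuousOn (continuousOn_const.mul hu)
  have h6 : ContinuousOn (fun x => Real.arctan (κ * v x)) Ω :=
    Real.continuous_arctan.comp_continuousOn (continuousOn_const.mul hv)
  unfold Psi PsiR
  refine ContinuousOn.add (ContinuousOn.div (by fun_prop) (by fun_prop) ?_)
    (ContinuousOn.mul (ContinuousOn.div (by fun_prop) (by fun_prop) ?_) (by fun_prop))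
  · intro x _; positivity
  · intro x _; positivity

lemma Err_cont {κ K c c' : ℝ} (hκ : 0 < κ) (h : Sol Ω A q₀ M q u) (h' : Sol Ω A q₀ M qt v) :
    ContinuousOn (fun x => ErrR κ K c c' (u x) (v x)) Ω := by
  have hu : ContinuousOn u Ω := h.uc.mono subset_closure
  have hv : ContinuousOn v Ω := h'.uc.mono subset_closure
  unfold ErrR
  refine ContinuousOn.add (ContinuousOn.add (ContinuousOn.mul continuousOn_const
    (ContinuousOn.div (by fun_prop) (by fun_prop) ?_)) (ContinuousOn.mul continuousOn_const
    (ContinuousOn.add (ContinuousOn.mul (by fun_prop) (ContinuousOn.div (by fun_prop) (by fun_prop) ?_))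
    (ContinuousOn.mul (by fun_prop) (ContinuousOn.div (by fun_prop) (by fun_prop) ?_)))))
    continuousOn_const
  all_goals intro x _; positivity

lemma KK_nonneg {n : ℕ} {Lam M : ℝ} (hL : 0 ≤ Lam) (hM : 0 ≤ M) : 0 ≤ KK n Lam M := by
  unfold KK; positivity
lemma c4_nonneg {n : ℕ} {Lam M q₀ : ℝ} (hL : 0 ≤ Lam) (hM : 0 ≤ M) : 0 ≤ c4 n Lam q₀ M := by
  have := KK_nonneg (n := n) hL hM
  unfold c4; positivity
lemma c5_nonneg (M : ℝ) : 0 ≤ c5 M := by unfold c5; positivity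

lemma Psi_le {κ : ℝ} (hκ : 0 < κ) (h : Sol Ω A q₀ M q u) (h' : Sol Ω A q₀ M qt v)
    (hE : Ell Ω A lam Lam) {x} (hx : x ∈ Ω) :
    |Psi A q₀ κ u v x| ≤ 16 * KK n Lam M + 8 * Real.sqrt q₀^2 * M^2 :=
  psi_bound hκ (h.ub x (subset_closure hx)) (h'.ub x (subset_closure hx))
    (h.IP_le h hE hx) (h.IP_le h' hE hx) (h'.IP_le h' hE hx)

lemma ibp1 {κ : ℝ} (hκ : 1 ≤ κ) (h : Sol Ω A q₀ M q u) (h' : Sol Ω A q₀ M qt v)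
    (hE : Ell Ω A lam Lam)
    (hq : ∀ x ∈ frontier Ω, q x = qt x) (hu : ∀ x ∈ frontier Ω, u x = v x) :
    ∫ x in Ω, Psi A q₀ κ u v x ≤
      C3 n Lam q₀ M * (∫ x in Ω, (|ww q qt u v x| + ‖fderiv ℝ (ww q qt u v) x‖)) +
      ∫ x in Ω, ErrR κ (KK n Lam M) (c4 n Lam q₀ M) (c5 M) (u x) (v x) := by
  have hκ0 : 0 < κ := by linarith
  have hκ' : 0 < κ⁻¹ := by positivity
  have hM := h.M0
  have hK0 := KK_nonneg (n := n) hE.Lpos hM.le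
  have hσ : 0 < Real.sqrt q₀ := Real.sqrt_pos.2 h.q0
  obtain ⟨hw1, hw2, -⟩ := ww_integ h h' hE
  obtain ⟨iu, hiu⟩ := ibp2 h h' hE hq hu h hκ0
  obtain ⟨iv, hiv⟩ := ibp2 h h' hE hq hu h' hκ0
  have iPsi : IntegrableOn (Psi A q₀ κ u v) Ω volume :=
    integ_of_cont hE (Psi_cont hκ0 h h' hE) (fun x hx => Psi_le hκ0 h h' hE hx)
  have iErr : IntegrableOn (fun x => ErrR κ (KK n Lam M) (c4 n Lam q₀ M) (c5 M) (u x) (v x)) Ω volume :=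
    integ_of_cont hE (Err_cont hκ0 h h') (fun x hx => err_bound hκ hK0
      (c4_nonneg hE.Lpos hM.le) (c5_nonneg M))
  set G : Fin n → EuclideanSpace ℝ (Fin n) → ℝ := fun i y => v y * flux A u i y - u y * flux A v i y with hG
  have hGc : ∀ i, ContDiffOn ℝ 1 (G i) Ω := fun i =>
    (h'.u1.mul (h.flux_c1 hE i)).sub (h.u1.mul (h'.flux_c1 hE i))
  have hPc : ContinuousOn (fun y => PhiR κ (u y) (v y)) (closure Ω) := PhiR_cont hκ0 h.uc h'.uc
  have hP0 : ∀ x ∈ frontier Ω, PhiR κ (u x) (v x) = 0 := fun x hx => by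
    simp [PhiR, hu x hx]
  obtain ⟨hcs, hts⟩ := cutoff hE.op hE.bd hPc hP0 hκ' (fun s hs => TT_eq_zero hκ' hs)
  have hfl := cutoff_lip hE.op hts (fun x hx =>
    (LLip.of_contDiffAt ((PhiR_contDiff hκ0 h.u1 h'.u1).contDiffAt (hE.op.mem_nhds hx))).comp_lip
      (TT_lip κ⁻¹))
  obtain ⟨hI, hI0⟩ := ibp_div hE.op hfl hcs hts hGc
  set f := Ω.indicator (fun x => TT κ⁻¹ (PhiR κ (u x) (v x))) with hf
  set w := ww q qt u v with hw
  set Du : EuclideanSpace ℝ (Fin n) → ℝ := fun x => |w x| * (κ / (1 + (κ * u x)^2) * IP A u u x) with hDu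
  set Dv : EuclideanSpace ℝ (Fin n) → ℝ := fun x => |w x| * (κ / (1 + (κ * v x)^2) * IP A v v x) with hDv
  set S := Real.sqrt M with hS
  set σ := Real.sqrt q₀ with hσd
  have hpt : ∀ x ∈ Ω, Psi A q₀ κ u v x ≤ (∑ i, (f x * pd i (G i) x + G i x * pd i f x)) +
      (ErrR κ (KK n Lam M) (c4 n Lam q₀ M) (c5 M) (u x) (v x) +
      (8 * S * M * |w x| + 2 / σ * (Dv x + Du x))) := by
    intro x hx
    have hxc := subset_closure hx
    have e := ibp1_sum hκ0 h h' hE hx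
    rw [hf, hG, e]
    have hpos : ∀ a : ℝ, 0 ≤ a * Real.arctan (κ * a) := by
      intro a
      rcases le_total 0 a with h0 | h0
      · exact mul_nonneg h0 (Real.arctan_nonneg.2 (by positivity))
      · exact mul_nonneg_of_nonpos_of_nonpos h0 (Real.arctan_le_zero.2
          (mul_nonpos_of_nonneg_of_nonpos hκ0.le h0))
    have hT : |TT κ⁻¹ (PhiR κ (u x) (v x)) - Real.arctan (κ * u x) * Real.arctan (κ * v x) *
        ((u x)^2 - (v x)^2) / ((u x)^2 + (v x)^2 + κ⁻¹)| ≤ 2 * κ⁻¹ := TT_near hκ' _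
    have := alg_main (M := M) (K := KK n Lam M) (σ := σ) (S := S) (u := u x) (v := v x)
      (s := Real.sqrt (q x)) (t := Real.sqrt (qt x)) (gg := IP A u u x) (gp := IP A u v x)
      (pp := IP A v v x) (τ := tau κ⁻¹ (PhiR κ (u x) (v x))) (ε := κ⁻¹)
      (du := κ / (1 + (κ * u x)^2)) (dv := κ / (1 + (κ * v x)^2))
      hσ (Real.sqrt_le_sqrt (h.qlo x hxc)) (Real.sqrt_le_sqrt (h'.qlo x hxc))
      (Real.sqrt_le_sqrt (h.qhi x hxc)) (Real.sqrt_le_sqrt (h'.qhi x hxc))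
      (h.ub x hxc) (h'.ub x hxc) (IP_nonneg hE hx) ((le_abs_self _).trans (h.IP_le h hE hx))
      (IP_nonneg hE hx) ((le_abs_self _).trans (h'.IP_le h' hE hx)) (h.IP_le h' hE hx)
      (tau_nonneg _ _) (tau_le_one _ _) hκ' (arctan_abs_le (κ * u x)) (arctan_abs_le (κ * v x))
      (hpos _) (hpos _) (by positivity) (by positivity) hκ'.le hT
    refine this.trans (le_of_eq ?_)
    congr 1
    have ew : abs (Real.sqrt (q x) * |u x| - Real.sqrt (qt x) * |v x|) = |w x| := rfl
    rw [ew]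
    simp only [ErrR, c4, c5, hDu, hDv]
    ring
  have iR : IntegrableOn (fun x => 8 * S * M * |w x| + 2 / σ * (Dv x + Du x)) Ω volume :=
    (hw1.const_mul _).add ((iv.add iu).const_mul _)
  have iER := iErr.add iR
  have step := setIntegral_mono_on iPsi (hI.add iER) hE.op.measurableSet hpt
  refine step.trans ?_
  have e1 := integral_add hI iER
  have e2 := integral_add iErr iR
  have e3 : ∫ x in Ω, (8 * S * M * |w x| + 2 / σ * (Dv x + Du x)) =
      8 * S * M * (∫ x in Ω, |w x|) + 2 / σ * ((∫ x in Ω, Dv x) + ∫ x in Ω, Du x) := by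
    have a1 := integral_add (hw1.const_mul (8 * S * M)) ((iv.add iu).const_mul (2 / σ))
    have a2 := integral_add iv iu
    simp only [Pi.add_apply] at a1 a2
    rw [a1, integral_const_mul, integral_const_mul, a2]
  simp only [Pi.add_apply] at e1 e2
  have hww : ∫ x in Ω, |w x| ≤ ∫ x in Ω, (|w x| + ‖fderiv ℝ w x‖) := by
    refine integral_mono hw1 (hw1.add hw2) fun x => ?_
    have := norm_nonneg (fderiv ℝ w x)
    simp only; linarith
  calc _ = (∫ x in Ω, ErrR κ (KK n Lam M) (c4 n Lam q₀ M) (c5 M) (u x) (v x)) +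
      (8 * S * M * (∫ x in Ω, |w x|) + 2 / σ * ((∫ x in Ω, Dv x) + ∫ x in Ω, Du x)) := by
        rw [← e3, ← e2, ← zero_add (∫ x in Ω, (_ + _)), ← hI0]
        exact e1
    _ ≤ _ := by
      have b1 : 8 * S * M * (∫ x in Ω, |w x|) ≤ 8 * S * M * ∫ x in Ω, (|w x| + ‖fderiv ℝ w x‖) := by
        gcongr
      have b2 : 2 / σ * ((∫ x in Ω, Dv x) + ∫ x in Ω, Du x) ≤
        2 / σ * (C2 n Lam M * (∫ x in Ω, (|w x| + ‖fderiv ℝ w x‖)) +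
          C2 n Lam M * (∫ x in Ω, (|w x| + ‖fderiv ℝ w x‖))) := by
        gcongr
      unfold C3
      linarith

end
lemma opnorm_le_sum {n : ℕ} (L : EuclideanSpace ℝ (Fin n) →L[ℝ] ℝ) :
    ‖L‖ ≤ ∑ i, |L (EuclideanSpace.single i 1)| := by
  refine L.opNorm_le_bound (Finset.sum_nonneg fun i _ => abs_nonneg _) fun x => ?_
  have e : x = ∑ i, x i • EuclideanSpace.single i (1:ℝ) := by
    have := (EuclideanSpace.basisFun (Fin n) ℝ).sum_repr x
    simpa using this.symm
  conv_lhs => rw [e]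
  rw [map_sum, Finset.sum_mul]
  refine (norm_sum_le _ _).trans (Finset.sum_le_sum fun i _ => ?_)
  rw [map_smul, norm_smul, mul_comm]
  exact mul_le_mul_of_nonneg_left (PiLp.norm_apply_le x i) (abs_nonneg _)

section
variable {n : ℕ} {Ω : Set (EuclideanSpace ℝ (Fin n))}
    {A : Fin n → Fin n → EuclideanSpace ℝ (Fin n) → ℝ} {q₀ M lam Lam : ℝ}
    {q qt u v : EuclideanSpace ℝ (Fin n) → ℝ}

def PsiL (A : Fin n → Fin n → EuclideanSpace ℝ (Fin n) → ℝ) (q₀ : ℝ)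
    (u v : EuclideanSpace ℝ (Fin n) → ℝ) (x : EuclideanSpace ℝ (Fin n)) : ℝ :=
  PsiLim (Real.sqrt q₀) (u x) (v x) (IP A u u x) (IP A u v x) (IP A v v x)

open Filter Topology in
lemma psi_lim (h : Sol Ω A q₀ M q u) (h' : Sol Ω A q₀ M qt v) (hE : Ell Ω A lam Lam)
    (hq : ∀ x ∈ frontier Ω, q x = qt x) (hu : ∀ x ∈ frontier Ω, u x = v x) :
    IntegrableOn (PsiL A q₀ u v) Ω volume ∧ ∫ x in Ω, PsiL A q₀ u v x ≤
      C3 n Lam q₀ M * (∫ x in Ω, (|ww q qt u v x| + ‖fderiv ℝ (ww q qt u v) x‖)) := by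
  have hfin : IsFiniteMeasure (volume.restrict Ω) := ⟨by simpa using hE.bd.measure_lt_top⟩
  have hM := h.M0
  have hK0 := KK_nonneg (n := n) hE.Lpos hM.le
  have hk : ∀ k : ℕ, (1:ℝ) ≤ (k:ℝ) + 1 := fun k => by
    have : (0:ℝ) ≤ k := Nat.cast_nonneg k
    linarith
  have hk0 : ∀ k : ℕ, (0:ℝ) < (k:ℝ) + 1 := fun k => lt_of_lt_of_le one_pos (hk k)
  set B := 16 * KK n Lam M + 8 * Real.sqrt q₀^2 * M^2 with hB
  have meas : ∀ k : ℕ, AEStronglyMeasurable (Psi A q₀ ((k:ℝ)+1) u v) (volume.restrict Ω) := fun k =>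
    (Psi_cont (hk0 k) h h' hE).aestronglyMeasurable hE.op.measurableSet
  have hlim : ∀ x, Tendsto (fun k : ℕ => Psi A q₀ ((k:ℝ)+1) u v x) atTop (𝓝 (PsiL A q₀ u v x)) :=
    fun x => (psi_tendsto _ _ _ _ _ _).comp kk_tendsto
  have hbd : ∀ k : ℕ, ∀ᵐ x ∂(volume.restrict Ω), ‖Psi A q₀ ((k:ℝ)+1) u v x‖ ≤ B := fun k =>
    (ae_restrict_iff' hE.op.measurableSet).2 (.of_forall fun x hx => Psi_le (hk0 k) h h' hE hx)
  have t1 := tendsto_integral_of_dominated_convergence (fun _ => B) meas (integrable_const B) hbd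
    (.of_forall hlim)
  have t2 : Tendsto (fun k : ℕ => ∫ x in Ω, ErrR ((k:ℝ)+1) (KK n Lam M) (c4 n Lam q₀ M) (c5 M) (u x) (v x))
      atTop (𝓝 (∫ x in Ω, (0:ℝ))) := by
    refine tendsto_integral_of_dominated_convergence
      (fun _ => 16 * KK n Lam M + 2 * c4 n Lam q₀ M + c5 M) ?_ (integrable_const _) ?_ ?_
    · exact fun k => (Err_cont (hk0 k) h h').aestronglyMeasurable hE.op.measurableSet
    · exact fun k => .of_forall fun x => err_bound (hk k) hK0 (c4_nonneg hE.Lpos hM.le) (c5_nonneg M)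
    · exact .of_forall fun x => (err_tendsto _ _ _ _ _).comp kk_tendsto
  refine ⟨?_, ?_⟩
  · refine Integrable.of_bound (aestronglyMeasurable_of_tendsto_ae atTop meas (.of_forall hlim)) B ?_
    have : ∀ᵐ x ∂(volume.restrict Ω), ∀ k : ℕ, ‖Psi A q₀ ((k:ℝ)+1) u v x‖ ≤ B := ae_all_iff.2 hbd
    filter_upwards [this] with x hx
    exact le_of_tendsto (hlim x).norm (.of_forall hx)
  · have t3 := t2.const_add (C3 n Lam q₀ M * (∫ x in Ω, (|ww q qt u v x| + ‖fderiv ℝ (ww q qt u v) x‖)))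
    rw [integral_zero, add_zero] at t3
    exact le_of_tendsto_of_tendsto' t1 t3 fun k => ibp1 (hk k) h h' hE hq hu

def C4 (lam q₀ M : ℝ) : ℝ :=
  16 * M^2 * (4 * Real.sqrt M / Real.sqrt q₀) / Real.sqrt q₀^2 + 2 * M^2 / lam +
    16 * M^2 * (2 * M / Real.sqrt q₀)

def ff (u v : EuclideanSpace ℝ (Fin n) → ℝ) (y : EuclideanSpace ℝ (Fin n)) : ℝ := (u y)^2 - (v y)^2

lemma ff_c1 (h : Sol Ω A q₀ M q u) (h' : Sol Ω A q₀ M qt v) : ContDiffOn ℝ 1 (ff u v) Ω :=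
  (h.u1.pow 2).sub (h'.u1.pow 2)

lemma ff_pd (h : Sol Ω A q₀ M q u) (h' : Sol Ω A q₀ M qt v) (hE : Ell Ω A lam Lam) {x} (hx : x ∈ Ω)
    (i : Fin n) : pd i (ff u v) x = 2 * (u x * pd i u x - v x * pd i v x) := by
  have d1 := h.diff hE hx
  have d2 := h'.diff hE hx
  have e : ff u v = fun y => u y * u y - v y * v y := by funext y; unfold ff; ring
  rw [e, pd_sub i (d1.fun_mul d1) (d2.fun_mul d2), pd_mul i d1 d1, pd_mul i d2 d2]
  ring

lemma ff_fderiv_le (h : Sol Ω A q₀ M q u) (h' : Sol Ω A q₀ M qt v) (hE : Ell Ω A lam Lam)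
    {x} (hx : x ∈ Ω) : ‖fderiv ℝ (ff u v) x‖ ≤ n * (4 * M^2) := by
  refine (opnorm_le_sum _).trans ?_
  calc ∑ i, |fderiv ℝ (ff u v) x (EuclideanSpace.single i 1)| ≤ ∑ i : Fin n, 4 * M^2 := by
        refine Finset.sum_le_sum fun i _ => ?_
        have := ff_pd h h' hE hx i
        unfold pd at this
        rw [this]
        have hM := h.M0
        have a1 := h.ub x (subset_closure hx)
        have a2 := h'.ub x (subset_closure hx)
        have a3 := h.pd_le hx i
        have a4 := h'.pd_le hx i
        have b1 : |u x * pd i u x| ≤ M * M := by rw [abs_mul]; gcongr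
        have b2 : |v x * pd i v x| ≤ M * M := by rw [abs_mul]; gcongr
        unfold pd at b1 b2
        have b1 := abs_le.1 b1
        have b2 := abs_le.1 b2
        rw [abs_le]; constructor <;> linarith
    _ = _ := by simp

lemma C4_nonneg (hl : 0 < lam) (hM : 0 ≤ M) : 0 ≤ C4 lam q₀ M := by unfold C4; positivity

lemma grad_pt (h : Sol Ω A q₀ M q u) (h' : Sol Ω A q₀ M qt v) (hE : Ell Ω A lam Lam)
    {x} (hx : x ∈ Ω) : |ff u v x| * ‖fderiv ℝ (ff u v) x‖ ≤
      n * C4 lam q₀ M * (PsiL A q₀ u v x + |ww q qt u v x|) := by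
  have hxc := subset_closure hx
  have hC := C4_nonneg (q₀ := q₀) hE.pos h.M0.le
  by_cases hab : (u x)^2 = (v x)^2
  · have : ff u v x = 0 := by unfold ff; rw [hab, sub_self]
    rw [this, abs_zero, zero_mul]
    have : PsiL A q₀ u v x = 0 := by unfold PsiL PsiLim; rw [if_pos hab]
    rw [this]
    positivity
  have hR : 0 < (u x)^2 + (v x)^2 := by
    rcases (by positivity : 0 ≤ (u x)^2 + (v x)^2).lt_or_eq with h0 | h0
    · exact h0
    · exfalso; apply hab; nlinarith [sq_nonneg (u x), sq_nonneg (v x)]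
  have hi : ∀ i, |ff u v x| * |fderiv ℝ (ff u v) x (EuclideanSpace.single i 1)| ≤
      C4 lam q₀ M * (PsiL A q₀ u v x + |ww q qt u v x|) := fun i => by
    have e := ff_pd h h' hE hx i
    have hN := IP_quad (u := u) (v := v) hE hx (v x) (u x) i
    have key := alg_grad (M := M) (S := Real.sqrt M) (Real.sqrt_pos.2 h.q0) (Real.sqrt_le_sqrt (h.qlo x hxc))
      (Real.sqrt_le_sqrt (h'.qlo x hxc))
      (Real.sqrt_le_sqrt (h.qhi x hxc)) (Real.sqrt_le_sqrt (h'.qhi x hxc)) hE.pos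
      (h.ub x hxc) (h'.ub x hxc) (h.pd_le hx i) (h'.pd_le hx i) hN hR
    rw [← e] at key
    refine key.trans ?_
    change C4 lam q₀ M * _ ≤ _
    refine mul_le_mul_of_nonneg_left ?_ hC
    refine add_le_add ?_ le_rfl
    unfold PsiL PsiLim
    rw [if_neg hab]
    have hN0 : 0 ≤ (v x)^2 * IP A u u x - 2 * u x * v x * IP A u v x + (u x)^2 * IP A v v x :=
      le_trans (mul_nonneg hE.pos.le (sq_nonneg _)) hN
    have hpi : 1 ≤ Real.pi^2 := by nlinarith [Real.pi_gt_three]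
    refine le_mul_of_one_le_left ?_ hpi
    positivity
  calc _ ≤ |ff u v x| * ∑ i, |fderiv ℝ (ff u v) x (EuclideanSpace.single i 1)| :=
        mul_le_mul_of_nonneg_left (opnorm_le_sum _) (abs_nonneg _)
    _ ≤ ∑ i : Fin n, C4 lam q₀ M * (PsiL A q₀ u v x + |ww q qt u v x|) := by
        rw [Finset.mul_sum]; exact Finset.sum_le_sum fun i _ => hi i
    _ = _ := by simp; ring

lemma ff_integ (h : Sol Ω A q₀ M q u) (h' : Sol Ω A q₀ M qt v) (hE : Ell Ω A lam Lam) :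
    IntegrableOn (fun x => |ff u v x| * ‖fderiv ℝ (ff u v) x‖) Ω volume := by
  have hM := h.M0
  refine integ_of_cont hE ((ff_c1 h h').continuousOn.abs.mul
    ((ff_c1 h h').continuousOn_fderiv_of_isOpen hE.op le_rfl).norm) (B := 2 * M^2 * (n * (4 * M^2))) ?_
  intro x hx
  rw [abs_mul, abs_abs, abs_norm]
  have a1 := abs_le.1 (h.ub x (subset_closure hx))
  have a2 := abs_le.1 (h'.ub x (subset_closure hx))
  have : |ff u v x| ≤ 2 * M^2 := by
    unfold ff; rw [abs_le]; constructor <;> nlinarith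
  have := ff_fderiv_le h h' hE hx
  gcongr

lemma grad_est (h : Sol Ω A q₀ M q u) (h' : Sol Ω A q₀ M qt v) (hE : Ell Ω A lam Lam)
    (hq : ∀ x ∈ frontier Ω, q x = qt x) (hu : ∀ x ∈ frontier Ω, u x = v x) :
    ∫ x in Ω, |ff u v x| * ‖fderiv ℝ (ff u v) x‖ ≤ n * C4 lam q₀ M * (C3 n Lam q₀ M + 1) *
      (∫ x in Ω, (|ww q qt u v x| + ‖fderiv ℝ (ww q qt u v) x‖)) := by
  obtain ⟨hw1, hw2, -⟩ := ww_integ h h' hE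
  obtain ⟨i1, i2⟩ := psi_lim h h' hE hq hu
  have hC := C4_nonneg (q₀ := q₀) hE.pos h.M0.le
  have step := setIntegral_mono_on (ff_integ h h' hE) ((i1.add hw1).const_mul (n * C4 lam q₀ M))
    hE.op.measurableSet (fun x hx => grad_pt h h' hE hx)
  refine step.trans ?_
  rw [integral_const_mul, mul_assoc (_ * _)]
  refine mul_le_mul_of_nonneg_left ?_ (by positivity)
  have e := integral_add i1 hw1
  simp only [Pi.add_apply] at e ⊢
  rw [e]
  have hww : ∫ x in Ω, |ww q qt u v x| ≤ ∫ x in Ω, (|ww q qt u v x| + ‖fderiv ℝ (ww q qt u v) x‖) := by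
    refine integral_mono hw1 (hw1.add hw2) fun x => ?_
    have := norm_nonneg (fderiv ℝ (ww q qt u v) x)
    simp only; linarith
  linarith

/-- Cauchy-Schwarz -/
lemma cs_est (h : Sol Ω A q₀ M q u) (h' : Sol Ω A q₀ M qt v) (hE : Ell Ω A lam Lam) :
    ∫ x in Ω, (|ww q qt u v x| + ‖fderiv ℝ (ww q qt u v) x‖) ≤
      (1 + 2 * volume.real Ω) * H1Norm Ω (ww q qt u v) := by
  obtain ⟨hw1, hw2, hw3⟩ := ww_integ h h' hE
  have hfin : IsFiniteMeasure (volume.restrict Ω) := ⟨by simpa using hE.bd.measure_lt_top⟩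
  set w := ww q qt u v
  set J := ∫ x in Ω, ((w x)^2 + ‖fderiv ℝ w x‖^2) with hJ
  have hJ0 : 0 ≤ J := integral_nonneg fun x => by positivity
  have hH : H1Norm Ω w = Real.sqrt J := by rw [Real.sqrt_eq_rpow]; rfl
  rw [hH]
  have key : ∀ s > 0, ∫ x in Ω, (|w x| + ‖fderiv ℝ w x‖) ≤ s⁻¹ * J + 2 * s * volume.real Ω := by
    intro s hs
    have aux : ∀ a : ℝ, 0 ≤ a → a ≤ s⁻¹ * a^2 + s := by
      intro a ha
      have : s⁻¹ * a^2 + s - a = s⁻¹ * ((a - s/2)^2 + 3/4*s^2) := by field_simp; ring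
      have : 0 ≤ s⁻¹ * ((a - s/2)^2 + 3/4*s^2) := by positivity
      linarith
    have i3 := hw3.const_mul s⁻¹
    have i4 := integrable_const (μ := volume.restrict Ω) (2 * s)
    have e := integral_add i3 i4
    calc _ ≤ ∫ x in Ω, (s⁻¹ * ((w x)^2 + ‖fderiv ℝ w x‖^2) + 2 * s) := by
          refine integral_mono (hw1.add hw2) (i3.add i4) fun x => ?_
          have a1 := aux |w x| (abs_nonneg _)
          have a2 := aux ‖fderiv ℝ w x‖ (norm_nonneg _)
          rw [sq_abs] at a1
          simp only [Pi.add_apply]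
          linarith
      _ = _ := by
          rw [e, integral_const_mul, integral_const]
          simp only [smul_eq_mul, measureReal_restrict_apply_univ]; ring
  rcases hJ0.lt_or_eq with h0 | h0
  · have hs := Real.sqrt_pos.2 h0
    refine (key _ hs).trans (le_of_eq ?_)
    have : (Real.sqrt J)⁻¹ * J = Real.sqrt J := by
      rw [inv_mul_eq_iff_eq_mul₀ hs.ne', Real.mul_self_sqrt hJ0]
    rw [this]; ring
  · rw [← h0, Real.sqrt_zero, mul_zero]
    refine le_of_forall_pos_le_add fun η hη => ?_
    have hv : 0 ≤ volume.real Ω := measureReal_nonneg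
    have := key (η / (2 * volume.real Ω + 1)) (by positivity)
    rw [← h0, mul_zero, zero_add] at this
    refine this.trans ?_
    rw [zero_add]
    have e : 2 * (η / (2 * volume.real Ω + 1)) * volume.real Ω = η * (2 * volume.real Ω) / (2 * volume.real Ω + 1) := by
      ring
    rw [e, div_le_iff₀ (by positivity)]
    nlinarith

end
lemma sobolev_est {n : ℕ} (hn : 2 ≤ n) : ∃ Cs : ℝ, 0 ≤ Cs ∧
    ∀ g : EuclideanSpace ℝ (Fin n) → ℝ, ContDiff ℝ 1 g → HasCompactSupport g →
    ∀ (x0 : EuclideanSpace ℝ (Fin n)) (r a : ℝ), 0 ≤ r → 0 ≤ a → (∀ y ∈ ball x0 r, a ≤ |g y|) →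
    a * r^(n-1) ≤ Cs * ∫ x, ‖fderiv ℝ g x‖ := by
  have hn0 : (2:ℝ) ≤ n := by exact_mod_cast hn
  have hnontriv : Nontrivial (EuclideanSpace ℝ (Fin n)) := by
    have : Nonempty (Fin n) := ⟨⟨0, by omega⟩⟩
    infer_instance
  set p : ℝ := (n:ℝ) / (n - 1) with hp
  have hp0 : 0 < p := by apply div_pos <;> linarith
  have hconj : Real.HolderConjugate (Module.finrank ℝ (EuclideanSpace ℝ (Fin n))) p := by
    rw [finrank_euclideanSpace_fin]
    exact Real.HolderConjugate.conjExponent (by linarith)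
  set C : NNReal := lintegralPowLePowLIntegralFDerivConst (volume : Measure (EuclideanSpace ℝ (Fin n))) p
  set ω : ℝ := (volume : Measure (EuclideanSpace ℝ (Fin n))).real (ball 0 1) with hω
  have hωfin : (volume : Measure (EuclideanSpace ℝ (Fin n))) (ball 0 1) ≠ ⊤ := measure_ball_lt_top.ne
  have hω0 : 0 < ω := by
    rw [hω, measureReal_def]
    exact ENNReal.toReal_pos (measure_ball_pos _ _ one_pos).ne' hωfin
  refine ⟨((C:ℝ) / ω)^(1/p), by positivity, ?_⟩
  intro g hg hgc x0 r a hr ha hb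
  set J := ∫ x, ‖fderiv ℝ g x‖ with hJ
  have hJ0 : 0 ≤ J := integral_nonneg fun x => norm_nonneg _
  have h1 := lintegral_pow_le_pow_lintegral_fderiv (volume : Measure (EuclideanSpace ℝ (Fin n))) hg hgc hconj
  have hitg : Integrable (fderiv ℝ g) volume :=
    (hg.continuous_fderiv (by norm_num)).integrable_of_hasCompactSupport (hgc.fderiv ℝ)
  rw [← ofReal_integral_norm_eq_lintegral_enorm hitg, ← hJ,
    ENNReal.ofReal_rpow_of_nonneg hJ0 hp0.le] at h1
  have h2 : ENNReal.ofReal (a^p * (r^n * ω)) ≤ ∫⁻ x, ‖g x‖ₑ ^ p := by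
    calc ENNReal.ofReal (a^p * (r^n * ω)) = ENNReal.ofReal (a^p) * volume (ball x0 r) := by
          rw [Measure.addHaar_ball volume x0 hr, finrank_euclideanSpace_fin,
            ENNReal.ofReal_mul (by positivity), ENNReal.ofReal_mul (by positivity), hω,
            measureReal_def, ENNReal.ofReal_toReal hωfin]
      _ = ∫⁻ x in ball x0 r, ENNReal.ofReal (a^p) := by rw [setLIntegral_const]
      _ ≤ ∫⁻ x in ball x0 r, ‖g x‖ₑ ^ p := by
          refine setLIntegral_mono' measurableSet_ball fun y hy => ?_
          rw [← ENNReal.ofReal_rpow_of_nonneg ha hp0.le]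
          refine ENNReal.rpow_le_rpow ?_ hp0.le
          rw [← ofReal_norm]
          exact ENNReal.ofReal_le_ofReal (hb y hy)
      _ ≤ _ := setLIntegral_le_lintegral _ _
  have h3 := h2.trans h1
  have eC : (C : ENNReal) * ENNReal.ofReal (J^p) = ENNReal.ofReal ((C:ℝ) * J^p) := by
    rw [ENNReal.ofReal_mul (by positivity), ENNReal.ofReal_coe_nnreal]
  rw [eC, ENNReal.ofReal_le_ofReal_iff (by positivity)] at h3
  have e1 : (a * r^(n-1))^p = a^p * r^n := by
    rw [Real.mul_rpow ha (by positivity)]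
    congr 1
    rw [← Real.rpow_natCast, ← Real.rpow_mul hr, ← Real.rpow_natCast]
    congr 1
    rw [Nat.cast_sub (by omega), hp]
    have : (n:ℝ) - 1 ≠ 0 := by linarith
    push_cast
    field_simp
  have e2 : (((C:ℝ) / ω)^(1/p) * J)^p = (C:ℝ) / ω * J^p := by
    rw [Real.mul_rpow (by positivity) hJ0, ← Real.rpow_mul (by positivity), one_div,
      inv_mul_cancel₀ hp0.ne', Real.rpow_one]
  rw [← Real.rpow_le_rpow_iff (by positivity) (by positivity) hp0, e1, e2, div_mul_eq_mul_div,
    le_div_iff₀ hω0]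
  linarith

lemma ball_sub_dom {n : ℕ} {Ω : Set (EuclideanSpace ℝ (Fin n))} (hΩ : IsOpen Ω)
    {f : EuclideanSpace ℝ (Fin n) → ℝ} (hf : ContDiffOn ℝ 1 f Ω)
    (hfc : ContinuousOn f (closure Ω)) (hf0 : ∀ x ∈ frontier Ω, f x = 0) {K : ℝ} (hK : 0 < K)
    (hfd : ∀ x ∈ Ω, ‖fderiv ℝ f x‖ ≤ K) {x0} (hx0 : x0 ∈ Ω) (hm : 0 < |f x0|) :
    ball x0 (|f x0| / (2 * K)) ⊆ Ω ∧ ∀ y ∈ ball x0 (|f x0| / (2 * K)), |f x0| / 2 ≤ |f y| := by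
  have hd : ∀ x ∈ Ω, DifferentiableAt ℝ f x := fun x hx =>
    (hf.contDiffAt (hΩ.mem_nhds hx)).differentiableAt (by norm_num)
  have hlip : ∀ r, ball x0 r ⊆ Ω → ∀ y ∈ ball x0 r, |f y - f x0| ≤ K * ‖y - x0‖ := by
    intro r hr y hy
    have hr0 : 0 < r := pos_of_mem_ball hy
    exact (convex_ball x0 r).norm_image_sub_le_of_norm_fderiv_le (fun a ha => hd a (hr ha))
      (fun a ha => hfd a (hr ha)) (mem_ball_self hr0) hy
  set r := |f x0| / (2 * K) with hr
  have hr0 : 0 < r := by positivity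
  have hsub : ball x0 r ⊆ Ω := by
    by_contra hc
    obtain ⟨y, hy, hyΩ⟩ := not_subset.1 hc
    have hne : (Ωᶜ).Nonempty := ⟨y, hyΩ⟩
    obtain ⟨z, hz, hzd⟩ := hΩ.isClosed_compl.exists_infDist_eq_dist hne x0
    set d := infDist x0 Ωᶜ with hdd
    have hdr : d < r := lt_of_le_of_lt (infDist_le_dist_of_mem hyΩ) (by rw [dist_comm]; exact hy)
    have hd0 : 0 < d := by
      rw [hzd]; apply dist_pos.2; rintro rfl; exact hz hx0
    have hbd : ball x0 d ⊆ Ω := by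
      have := ball_infDist_compl_subset (s := Ω) (x := x0)
      exact this
    have hzb : z ∈ closure (ball x0 d) := by
      rw [closure_ball x0 hd0.ne', mem_closedBall, dist_comm, ← hzd]
    have hzf : z ∈ frontier Ω := by
      rw [frontier, hΩ.interior_eq]; exact ⟨closure_mono hbd hzb, hz⟩
    have hcont : ContinuousWithinAt f (ball x0 d) z :=
      (hfc z hzf.1).mono (hbd.trans subset_closure)
    have h1 : |f z - f x0| ≤ K * d := by
      refine ContinuousWithinAt.closure_le hzb ((hcont.sub continuousWithinAt_const).abs)
        continuousWithinAt_const ?_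
      intro y hy
      refine (hlip d hbd y hy).trans ?_
      gcongr
      rw [← dist_eq_norm]; exact (mem_ball.1 hy).le
    rw [hf0 z hzf, zero_sub, abs_neg] at h1
    have : K * d ≤ K * r := by gcongr
    have : K * r = |f x0| / 2 := by rw [hr]; field_simp
    linarith
  refine ⟨hsub, fun y hy => ?_⟩
  have h1 := hlip r hsub y hy
  have h2 : K * ‖y - x0‖ ≤ K * r := by
    gcongr; rw [← dist_eq_norm]; exact (mem_ball.1 hy).le
  have h3 : K * r = |f x0| / 2 := by rw [hr]; field_simp
  have h4 := abs_sub_abs_le_abs_sub (f x0) (f y)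
  rw [abs_sub_comm] at h4
  linarith

lemma sup_est {n : ℕ} (hn : 2 ≤ n) : ∃ Cs : ℝ, 0 ≤ Cs ∧
    ∀ (Ω : Set (EuclideanSpace ℝ (Fin n))), IsOpen Ω → Bornology.IsBounded Ω →
    ∀ f : EuclideanSpace ℝ (Fin n) → ℝ, ContDiffOn ℝ 1 f Ω →
    ContinuousOn f (closure Ω) → (∀ x ∈ frontier Ω, f x = 0) → ∀ K : ℝ, 0 < K →
    (∀ x ∈ Ω, ‖fderiv ℝ f x‖ ≤ K) →
    IntegrableOn (fun x => |f x| * ‖fderiv ℝ f x‖) Ω volume → ∀ x0 ∈ Ω,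
    |f x0|^(n+1) ≤ Cs * K^(n-1) * ∫ x in Ω, |f x| * ‖fderiv ℝ f x‖ := by
  obtain ⟨Cs, hCs, hs⟩ := sobolev_est hn
  refine ⟨16 * 2^(n-1) * (2 * Cs), by positivity, ?_⟩
  intro Ω hΩ hb f hf hfc hf0 K hK hfd hitg x0 hx0
  have hI0 : 0 ≤ ∫ x in Ω, |f x| * ‖fderiv ℝ f x‖ := integral_nonneg fun x => by positivity
  by_cases hm : |f x0| = 0
  · rw [hm, zero_pow (by omega)]; positivity
  have hm0 : 0 < |f x0| := lt_of_le_of_ne (abs_nonneg _) (Ne.symm hm)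
  obtain ⟨b1, b2⟩ := ball_sub_dom hΩ hf hfc hf0 hK hfd hx0 hm0
  set m := |f x0| with hmd
  set δ := m / 8 with hδd
  have hδ : 0 < δ := by positivity
  obtain ⟨hcs, hts⟩ := cutoff hΩ hb hfc hf0 hδ (fun s hs => TT_eq_zero hδ hs)
  have hcd : ContDiff ℝ 1 (Ω.indicator fun x => TT δ (f x)) :=
    cutoff_contDiff hΩ hts ((TT_contDiff δ).comp_contDiffOn hf)
  set h := Ω.indicator (fun x => TT δ (f x)) with hh
  have hd : ∀ x ∈ Ω, DifferentiableAt ℝ f x := fun x hx =>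
    (hf.contDiffAt (hΩ.mem_nhds hx)).differentiableAt (by norm_num)
  have key := hs (fun x => h x * h x) (hcd.mul hcd) (hcs.mul_right) x0 (m / (2 * K)) ((m/4)^2)
    (by positivity) (by positivity) (fun y hy => by
      have e : h y = TT δ (f y) := indicator_of_mem (b1 hy) _
      have a1 := b2 y hy
      have a2 := TT_near hδ (f y)
      have a3 : m / 4 ≤ |TT δ (f y)| := by
        have := abs_sub_abs_le_abs_sub (f y) (TT δ (f y))
        rw [abs_sub_comm] at this
        linarith
      rw [e, abs_mul, ← sq]
      exact pow_le_pow_left₀ (by positivity) a3 2)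
  have hgrad : ∀ x, ‖fderiv ℝ (fun x => h x * h x) x‖ ≤ 2 * (Ω.indicator (fun x => |f x| * ‖fderiv ℝ f x‖) x) := by
    intro x
    have hdx : DifferentiableAt ℝ h x := hcd.differentiable (by norm_num) x
    rw [fderiv_fun_mul hdx hdx]
    have n1 : ‖h x • fderiv ℝ h x + h x • fderiv ℝ h x‖ ≤ 2 * (|h x| * ‖fderiv ℝ h x‖) := by
      refine (norm_add_le _ _).trans ?_
      rw [norm_smul, Real.norm_eq_abs]; linarith
    refine n1.trans ?_
    by_cases hx : x ∈ Ω
    · rw [indicator_of_mem hx]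
      have e : h x = TT δ (f x) := indicator_of_mem hx _
      have a1 : |h x| ≤ |f x| := by rw [e]; exact TT_abs_le _ _
      have a2 : ‖fderiv ℝ h x‖ ≤ ‖fderiv ℝ f x‖ := by
        refine fderiv_dom (hd x hx) ?_
        filter_upwards [hΩ.mem_nhds hx] with y hy
        have e' : h y = TT δ (f y) := indicator_of_mem hy _
        rw [e, e']
        simpa [Real.dist_eq] using (TT_lip δ).dist_le_mul (f y) (f x)
      gcongr
    · rw [indicator_of_notMem hx]
      have e : h x = 0 := indicator_of_notMem hx _
      rw [e]; simp
  have hI : ∫ x, ‖fderiv ℝ (fun x => h x * h x) x‖ ≤ 2 * ∫ x in Ω, |f x| * ‖fderiv ℝ f x‖ := by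
    rw [← integral_indicator hΩ.measurableSet, ← integral_const_mul]
    refine integral_mono_of_nonneg (.of_forall fun x => norm_nonneg _) ?_ (.of_forall hgrad)
    exact ((integrable_indicator_iff hΩ.measurableSet).2 hitg).const_mul 2
  have k2 := key.trans (mul_le_mul_of_nonneg_left hI hCs)
  have e : (m / 4)^2 * (m / (2 * K))^(n-1) = m^(n+1) / (16 * 2^(n-1) * K^(n-1)) := by
    have : n + 1 = 2 + (n - 1) := by omega
    rw [this, pow_add, div_pow, div_pow, mul_pow, div_mul_div_comm]
    norm_num
    ring
  rw [e, div_le_iff₀ (by positivity)] at k2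
  linarith

lemma ell_of {n : ℕ} {Ω : Set (EuclideanSpace ℝ (Fin n))} (hΩo : IsOpen Ω)
    (hΩb : Bornology.IsBounded Ω)
    {A : Fin n → Fin n → EuclideanSpace ℝ (Fin n) → ℝ} (hA : EllipticSym Ω A) :
    ∃ lam Lam : ℝ, Ell Ω A lam Lam := by
  obtain ⟨hs, hc, lam, hl, he⟩ := hA
  have hk : IsCompact (closure Ω) := hΩb.isCompact_closure
  have hb : ∀ i j, ∃ C : ℝ, ∀ x ∈ closure Ω, ‖A i j x‖ ≤ C := fun i j =>
    hk.exists_bound_of_continuousOn (hc i j).continuousOn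
  choose C hC using hb
  have h1 : ∀ i j, |C i j| ≤ ∑ i, ∑ j, |C i j| := fun i j =>
    (Finset.single_le_sum (f := fun j => |C i j|) (fun _ _ => abs_nonneg _)
      (Finset.mem_univ j)).trans
      (Finset.single_le_sum (f := fun i => ∑ j, |C i j|)
        (fun _ _ => Finset.sum_nonneg fun _ _ => abs_nonneg _) (Finset.mem_univ i))
  refine ⟨lam, ∑ i, ∑ j, |C i j|, hΩo, hΩb, fun i j x hx => hs i j x (subset_closure hx),
    fun i j => (hc i j).mono subset_closure, fun i j x hx => ?_,
    Finset.sum_nonneg fun _ _ => Finset.sum_nonneg fun _ _ => abs_nonneg _, hl, he⟩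
  have := hC i j x (subset_closure hx)
  rw [Real.norm_eq_abs] at this
  exact this.trans ((le_abs_self _).trans (h1 i j))

lemma sol_of {n : ℕ} {Ω : Set (EuclideanSpace ℝ (Fin n))} (hne : Ω.Nonempty)
    {A : Fin n → Fin n → EuclideanSpace ℝ (Fin n) → ℝ} {q₀ M : ℝ} (hq₀ : 0 < q₀) (hM : 0 < M)
    {q u : EuclideanSpace ℝ (Fin n) → ℝ} (hq : W1InfBound Ω q M) (hlo : ∀ x ∈ closure Ω, q₀ ≤ q x)
    (hu : C2BoundOn Ω u M) (hs : IsSolution A q u Ω) : Sol Ω A q₀ M q u := by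
  obtain ⟨K, hK, hb⟩ := hq
  obtain ⟨y, hy⟩ := hne
  refine ⟨hq₀, hM, ⟨K, ?_, hK⟩, hlo, fun x hx => ?_, hu.1.continuousOn, hu.1.mono subset_closure,
    hu.2.1, fun x hx => ?_, hs⟩
  · have := hb y (subset_closure hy)
    have := abs_nonneg (q y)
    linarith
  · have := hb x hx
    have := le_abs_self (q x)
    have := K.2
    have h0 : (0:ℝ) ≤ (K:ℝ) := K.2
    linarith
  · have := (hu.2.2 x hx).1
    rwa [norm_iteratedFDeriv_one] at this

lemma C3_nonneg {n : ℕ} {Lam q₀ M : ℝ} (hL : 0 ≤ Lam) (hM : 0 ≤ M) : 0 ≤ C3 n Lam q₀ M := by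
  unfold C3 C2; positivity

lemma interp {n : ℕ} {m B C₁ h θ : ℝ} (hm : 0 ≤ m) (hB : m ≤ B) (hC : 0 ≤ C₁) (hh : 0 ≤ h)
    (hθ : 0 < θ) (hθn : θ * (n + 1 : ℕ) < 1) (hle : m ^ (n + 1) ≤ C₁ * h) :
    m ≤ (B ^ (1 - θ * (n + 1 : ℕ)) * C₁ ^ θ + 1) * h ^ θ := by
  have e : m = m ^ (1 - θ * (n + 1 : ℕ)) * (m ^ (n + 1)) ^ θ := by
    rcases hm.eq_or_lt with h0 | h0
    · rw [← h0, Real.zero_rpow (by linarith), zero_mul]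
    · rw [← Real.rpow_natCast, ← Real.rpow_mul hm, ← Real.rpow_add h0]
      conv_lhs => rw [← Real.rpow_one m]
      congr 1; ring
  have h1 : m ^ (1 - θ * (n + 1 : ℕ)) ≤ B ^ (1 - θ * (n + 1 : ℕ)) :=
    Real.rpow_le_rpow hm hB (by linarith)
  have h2 : (m ^ (n + 1)) ^ θ ≤ C₁ ^ θ * h ^ θ := by
    rw [← Real.mul_rpow hC hh]
    exact Real.rpow_le_rpow (by positivity) hle hθ.le
  have hB0 : 0 ≤ B := hm.trans hB
  have h3 : 0 ≤ h ^ θ := Real.rpow_nonneg hh _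
  calc m = _ := e
    _ ≤ B ^ (1 - θ * (n + 1 : ℕ)) * (C₁ ^ θ * h ^ θ) :=
        mul_le_mul h1 h2 (by positivity) (by positivity)
    _ ≤ _ := by nlinarith

theorem stmt_5 {n : ℕ} (hn : n = 2 ∨ n = 3)
    (Ω : Set (EuclideanSpace ℝ (Fin n)))
    (hΩo : IsOpen Ω) (hΩb : Bornology.IsBounded Ω) (hΩc : IsConnected Ω)
    (hΩreg : IsC11Boundary Ω)
    (A : Fin n → Fin n → EuclideanSpace ℝ (Fin n) → ℝ) (hA : EllipticSym Ω A)
    (q₀ M θ : ℝ) (hq₀ : 0 < q₀) (hM : 0 < M) (hθ : 0 < θ) (hθ' : θ < 1 / 4) :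
    ∃ C > 0, ∀ q qt u ut : EuclideanSpace ℝ (Fin n) → ℝ,
      (∀ x ∈ frontier Ω, q x = qt x) →
      W1InfBound Ω q M → W1InfBound Ω qt M →
      (∀ x ∈ closure Ω, q₀ ≤ q x) → (∀ x ∈ closure Ω, q₀ ≤ qt x) →
      C2BoundOn Ω u M → C2BoundOn Ω ut M →
      IsSolution A q u Ω → IsSolution A qt ut Ω →
      (∀ x ∈ frontier Ω, u x = ut x) →
      ∀ x ∈ Ω, |(u x) ^ 2 - (ut x) ^ 2| ≤
        C * (H1Norm Ω
          (fun y => Real.sqrt (q y) * |u y| - Real.sqrt (qt y) * |ut y|)) ^ θ := by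
  obtain ⟨lam, Lam, hE⟩ := ell_of hΩo hΩb hA
  have hn2 : 2 ≤ n := by omega
  have hn3 : n ≤ 3 := by omega
  obtain ⟨Cs, hCs, hsup⟩ := sup_est hn2
  have hnpos : (0:ℝ) < n := by exact_mod_cast (by omega : 0 < n)
  have hK : 0 < (n:ℝ) * (4 * M^2) := by positivity
  have hC4 := C4_nonneg (q₀ := q₀) hE.pos hM.le
  have hC3 := C3_nonneg (n := n) (q₀ := q₀) hE.Lpos hM.le
  set D : ℝ := n * C4 lam q₀ M * (C3 n Lam q₀ M + 1) with hD
  have hD0 : 0 ≤ D := by positivity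
  set E : ℝ := 1 + 2 * volume.real Ω with hEE
  have hE0 : 0 ≤ E := by
    have : 0 ≤ volume.real Ω := measureReal_nonneg
    rw [hEE]; linarith
  set F : ℝ := Cs * ((n:ℝ) * (4 * M^2)) ^ (n - 1) with hF
  have hF0 : 0 ≤ F := by positivity
  refine ⟨(M^2) ^ (1 - θ * (n + 1 : ℕ)) * (F * (D * E)) ^ θ + 1, by positivity, ?_⟩
  intro q qt u ut hq hwq hwqt hlo hlot hu hut hs hst huu x hx
  have h : Sol Ω A q₀ M q u := sol_of hΩc.nonempty hq₀ hM hwq hlo hu hs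
  have h' : Sol Ω A q₀ M qt ut := sol_of hΩc.nonempty hq₀ hM hwqt hlot hut hst
  have g1 := grad_est h h' hE hq huu
  have g2 := cs_est h h' hE
  have g3 := hsup Ω hΩo hΩb (ff u ut) (ff_c1 h h') ((h.uc.pow 2).sub (h'.uc.pow 2))
    (fun y hy => by simp [ff, huu y hy]) _ hK (fun y hy => ff_fderiv_le h h' hE hy)
    (ff_integ h h' hE) x hx
  have hH : 0 ≤ H1Norm Ω (ww q qt u ut) := by
    unfold H1Norm
    exact Real.rpow_nonneg (integral_nonneg fun y => by positivity) _
  refine interp (abs_nonneg _) ?_ (by positivity) hH hθ ?_ ?_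
  · have a1 := h.ub x (subset_closure hx)
    have a2 := h'.ub x (subset_closure hx)
    have b1 : (u x)^2 ≤ M^2 := sq_le_sq' (by linarith [neg_abs_le (u x)]) (by linarith [le_abs_self (u x)])
    have b2 : (ut x)^2 ≤ M^2 := sq_le_sq' (by linarith [neg_abs_le (ut x)]) (by linarith [le_abs_self (ut x)])
    rw [abs_le]
    constructor <;> nlinarith [sq_nonneg (u x), sq_nonneg (ut x)]
  · have : ((n + 1 : ℕ) : ℝ) ≤ 4 := by exact_mod_cast (by omega : n + 1 ≤ 4)
    nlinarith
  · refine g3.trans ?_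
    calc _ ≤ F * (D * (E * H1Norm Ω (ww q qt u ut))) :=
          mul_le_mul_of_nonneg_left (g1.trans (mul_le_mul_of_nonneg_left g2 hD0)) hF0
      _ = _ := by ring_nf; rfl
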